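/- arXiv:2508.09368 — 7 statements merged into one kernel-verified Lean document; each statement's English description precedes it below -/
import Mathlib

section
/- The set Mon = {X ∈ SF : X is a Montel space} is a coanalytic subset of SF. -/
open MeasureTheory Set Topology

noncomputable section

/-- `C(ℝ)`: continuous real-valued functions on `ℝ` with the compact-open topology,
which coincides with the topology of uniform convergence on compact subsets of `ℝ`. -/
abbrev CR : Type := C(ℝ, ℝ)

/-- `SF`: the set of closed linear subspaces of `C(ℝ)`. -/
def SF : Set (Submodule ℝ CR) := {p | IsClosed (p : Set CR)}

/-- The Effros Borel structure on `SF`, generated by the sets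
`{X ∈ SF : X ∩ U ≠ ∅}` for `U` open in `C(ℝ)`. -/
instance : MeasurableSpace SF :=
  MeasurableSpace.generateFrom
    {A : Set SF | ∃ U : Set CR, IsOpen U ∧
      A = {X : SF | (((X : Submodule ℝ CR) : Set CR) ∩ U).Nonempty}}

/-- A subset of a measurable space is analytic if it is the image of a Polish space
under a Borel map. -/
def IsAnalyticIn {α : Type*} [MeasurableSpace α] (A : Set α) : Prop :=
  ∃ (Z : Type) (tZ : TopologicalSpace Z), @PolishSpace Z tZ ∧
    ∃ f : Z → α, @Measurable Z α (@borel Z tZ) _ f ∧ Set.range f = A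

/-- `X ∈ SF` is Montel if every closed (von Neumann-)bounded subset of `X` is compact. -/
def IsMontel (X : SF) : Prop :=
  ∀ s : Set ↥(X : Submodule ℝ CR), IsClosed s → Bornology.IsVonNBounded ℝ s → IsCompact s

def Mon : Set SF := {X | IsMontel X}

open Filter

instance polishSpace_CR : PolishSpace CR :=
  letI := UniformSpace.pseudoMetricSpace CR
  inferInstance

/-- A sequence of vectors `w` (indexed by `ℕ ⊕ ℕ`) together with witnesses that
`n ↦ w (inl n)` is bounded and uniformly separated on a compact interval. -/
abbrev WitnessSpace : Type := (ℕ ⊕ ℕ → CR) × (ℕ → ℝ) × (ℕ → ℕ → ℝ) × ℝ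

/-- The witnesses `(w, M, t, R)` such that `n ↦ w (inl n)` is bounded by `M k` on `[-k, k]` and
any two distinct terms differ by at least `1` at a point of `[-R, R]`. -/
def separatedWitnesses : Set WitnessSpace :=
  {z | (∀ (n k : ℕ) (x : ℝ), |x| ≤ k → |z.1 (.inl n) x| ≤ z.2.1 k) ∧
    ∀ m n : ℕ, m < n → |z.2.2.1 m n| ≤ z.2.2.2 ∧
      1 ≤ |z.1 (.inl m) (z.2.2.1 m n) - z.1 (.inl n) (z.2.2.1 m n)|}

theorem isClosed_separatedWitnesses : IsClosed separatedWitnesses := by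
  have hev : Continuous fun p : CR × ℝ => p.1 p.2 := continuous_eval
  have hw (i : ℕ ⊕ ℕ) : Continuous fun z : WitnessSpace => z.1 i :=
    (continuous_apply i).comp continuous_fst
  have ht (m n : ℕ) : Continuous fun z : WitnessSpace => z.2.2.1 m n := by fun_prop
  have hwt (i : ℕ ⊕ ℕ) (m n : ℕ) : Continuous fun z : WitnessSpace => z.1 i (z.2.2.1 m n) :=
    hev.comp ((hw i).prodMk (ht m n))
  have hwx (i : ℕ ⊕ ℕ) (x : ℝ) : Continuous fun z : WitnessSpace => z.1 i x :=
    hev.comp ((hw i).prodMk continuous_const)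
  unfold separatedWitnesses
  simp only [Set.ofPred_and, Set.ofPred_forall]
  refine IsClosed.inter ?_ ?_
  · refine isClosed_iInter fun n => isClosed_iInter fun k => isClosed_iInter fun x =>
      isClosed_iInter fun _ => isClosed_le (hwx _ x).abs (by fun_prop)
  · refine isClosed_iInter fun m => isClosed_iInter fun n => isClosed_iInter fun _ =>
      IsClosed.inter (isClosed_le (ht m n).abs (by fun_prop))
        (isClosed_le continuous_const ((hwt _ m n).sub (hwt _ m n)).abs)

/-- The closed linear span of a family of functions. -/
def closedSpan {ι : Type*} (w : ι → CR) : SF :=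
  ⟨(Submodule.span ℝ (range w)).topologicalClosure,
    Submodule.isClosed_topologicalClosure _⟩

theorem mem_closedSpan {ι : Type*} (w : ι → CR) (i : ι) :
    w i ∈ (closedSpan w : Submodule ℝ CR) :=
  Submodule.le_topologicalClosure _ (Submodule.subset_span (mem_range_self i))

theorem isOpen_closedSpan_inter_nonempty {ι : Type*} {U : Set CR} (hU : IsOpen U) :
    IsOpen {w : ι → CR | (((closedSpan w : Submodule ℝ CR) : Set CR) ∩ U).Nonempty} := by
  have h : {w : ι → CR | (((closedSpan w : Submodule ℝ CR) : Set CR) ∩ U).Nonempty} =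
      ⋃ c : ι →₀ ℝ, {w | (c.sum fun i a => a • w i) ∈ U} := by
    ext w
    simp only [closedSpan, Submodule.topologicalClosure_coe, mem_ofPred_eq, mem_iUnion,
      closure_inter_open_nonempty_iff hU]
    constructor
    · rintro ⟨g, hg, hgU⟩
      obtain ⟨c, rfl⟩ := Finsupp.mem_span_range_iff_exists_finsupp.1 hg
      exact ⟨c, hgU⟩
    · rintro ⟨c, hc⟩
      exact ⟨_, Finsupp.mem_span_range_iff_exists_finsupp.2 ⟨c, rfl⟩, hc⟩
  rw [h]
  refine isOpen_iUnion fun c => hU.preimage ?_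
  unfold Finsupp.sum
  fun_prop

theorem closedSpan_eq_of_dense {ι : Type*} {X : SF} {w : ι → CR}
    (hw : ∀ i, w i ∈ (X : Submodule ℝ CR))
    (hX : ((X : Submodule ℝ CR) : Set CR) ⊆ closure (range w)) : closedSpan w = X := by
  apply Subtype.ext
  apply le_antisymm
  · refine Submodule.topologicalClosure_minimal _ ?_ X.2
    exact Submodule.span_le.2 (range_subset_iff.2 hw)
  · exact fun g hg => closure_mono Submodule.subset_span (hX hg)

theorem isVonNBounded_of_forall_abs_le {p : Submodule ℝ CR} (M : ℕ → ℝ) :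
    Bornology.IsVonNBounded ℝ {f : p | ∀ (k : ℕ) (x : ℝ), |x| ≤ k → |(f : CR) x| ≤ M k} := by
  refine Bornology.isVonNBounded_of_smul_tendsto_zero (l := atTop)
    (ε := fun n : ℕ => 1 / ((n : ℝ) + 1)) (.of_forall fun n => by positivity) fun u hu => ?_
  rw [tendsto_subtype_rng, ContinuousMap.tendsto_iff_forall_isCompact_tendstoUniformlyOn]
  intro K hK
  obtain ⟨r, hr⟩ := hK.isBounded.exists_norm_le
  obtain ⟨k, hk⟩ := exists_nat_ge r
  rw [Metric.tendstoUniformlyOn_iff]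
  intro ε hε
  have hlim : Tendsto (fun n : ℕ => 1 / ((n : ℝ) + 1) * M k) atTop (𝓝 0) := by
    simpa using (tendsto_one_div_add_atTop_nhds_zero_nat (𝕜 := ℝ)).mul_const (M k)
  filter_upwards [hlim.eventually_lt_const hε] with n hn x hx
  have hb := hu n k x ((hr x hx).trans hk)
  have hpos : 0 ≤ 1 / ((n : ℝ) + 1) := by positivity
  simp only [ZeroMemClass.coe_zero, ContinuousMap.zero_apply, dist_zero_left, Pi.smul_apply',
    SetLike.val_smul, ContinuousMap.smul_apply, smul_eq_mul, Real.norm_eq_abs, abs_mul,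
    abs_of_nonneg hpos]
  exact (mul_le_mul_of_nonneg_left hb hpos).trans_lt hn

theorem not_isMontel_of_separated {X : SF} {y : ℕ → CR} (hy : ∀ n, y n ∈ (X : Submodule ℝ CR))
    {M : ℕ → ℝ} (hM : ∀ (n k : ℕ) (x : ℝ), |x| ≤ k → |y n x| ≤ M k) {R : ℝ}
    (hR : ∀ m n : ℕ, m < n → ∃ x : ℝ, |x| ≤ R ∧ 1 ≤ |y m x - y n x|) : ¬ IsMontel X := by
  intro hX
  have hclosed : IsClosed
      {f : (X : Submodule ℝ CR) | ∀ (k : ℕ) (x : ℝ), |x| ≤ k → |(f : CR) x| ≤ M k} := by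
    simp only [Set.ofPred_forall]
    refine isClosed_iInter fun k => isClosed_iInter fun x => isClosed_iInter fun _ => ?_
    exact isClosed_le
      ((continuous_eval_const x).comp continuous_subtype_val).abs continuous_const
  have : SecondCountableTopology (X : Submodule ℝ CR) :=
    IsEmbedding.subtypeVal.secondCountableTopology
  obtain ⟨a, -, φ, hφ, hlim⟩ := (hX _ hclosed (isVonNBounded_of_forall_abs_le M)).tendsto_subseq
    (x := fun n => (⟨y n, hy n⟩ : (X : Submodule ℝ CR))) hM
  rw [tendsto_subtype_rng, ContinuousMap.tendsto_iff_forall_isCompact_tendstoUniformlyOn] at hlim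
  have h := Metric.tendstoUniformlyOn_iff.1 (hlim (Icc (-R) R) isCompact_Icc) (1 / 2) (by norm_num)
  obtain ⟨N, hN⟩ := eventually_atTop.1 h
  obtain ⟨x, hx, hsep⟩ := hR (φ N) (φ (N + 1)) (hφ N.lt_succ_self)
  have h1 := hN N le_rfl x (abs_le.1 hx)
  have h2 := hN (N + 1) N.le_succ x (abs_le.1 hx)
  have h3 := dist_triangle_left (y (φ N) x) (y (φ (N + 1)) x) ((a : CR) x)
  rw [Real.dist_eq (y (φ N) x)] at h3
  simp only [Function.comp_apply] at h1 h2
  linarith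

theorem exists_bound_of_isVonNBounded {s : Set CR} (hs : Bornology.IsVonNBounded ℝ s) :
    ∃ M : ℕ → ℝ, ∀ f ∈ s, ∀ (k : ℕ) (x : ℝ), |x| ≤ k → |f x| ≤ M k := by
  have key : ∀ k : ℕ, ∃ M : ℝ, ∀ f ∈ s, ∀ x : ℝ, |x| ≤ k → |f x| ≤ M := by
    intro k
    have hV : {f : CR | MapsTo f (Icc (-(k : ℝ)) k) (Metric.ball 0 1)} ∈ 𝓝 (0 : CR) :=
      (ContinuousMap.isOpen_setOfPred_mapsTo isCompact_Icc Metric.isOpen_ball).mem_nhds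
        fun x _ => by simp
    obtain ⟨r, hr, h⟩ := (hs hV).exists_pos
    refine ⟨r, fun f hf x hx => ?_⟩
    obtain ⟨g, hg, rfl⟩ := h r (le_abs_self r) hf
    have h1 := hg (abs_le.1 hx)
    rw [mem_ball_zero_iff, Real.norm_eq_abs] at h1
    simp only [ContinuousMap.smul_apply, smul_eq_mul, abs_mul, abs_of_pos hr]
    nlinarith
  choose M hM using key
  exact ⟨M, fun f hf k x hx => hM k f hf x hx⟩

theorem exists_separated_seq_of_not_totallyBounded {s : Set CR} (hs : ¬ TotallyBounded s) :
    ∃ (u : ℕ → CR) (R ε : ℝ), 0 < ε ∧ (∀ n, u n ∈ s) ∧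
      ∀ m n : ℕ, m < n → ∃ x : ℝ, |x| ≤ R ∧ ε ≤ |u m x - u n x| := by
  rw [Metric.uniformity_basis_dist.compactConvergenceUniformity.totallyBounded_iff] at hs
  push Not at hs
  obtain ⟨⟨K, ε⟩, ⟨hK, hε⟩, h⟩ := hs
  obtain ⟨R, hR⟩ := hK.isBounded.exists_norm_le
  obtain ⟨u, hu⟩ := seq_of_forall_finite_exists
    (P := fun f t => f ∈ s ∧ ∀ g ∈ t, ∃ x : ℝ, |x| ≤ R ∧ ε ≤ |g x - f x|) fun t ht => by
      obtain ⟨f, hf, hft⟩ := not_subset.1 (h t ht)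
      refine ⟨f, hf, fun g hg => ?_⟩
      by_contra! hlt
      refine hft (mem_biUnion hg fun x hx => ?_)
      simpa [Real.dist_eq, abs_sub_comm] using hlt x (hR x hx)
  exact ⟨u, R, ε, hε, fun n => (hu n).1, fun m n hmn => (hu n).2 _ ⟨m, hmn, rfl⟩⟩

theorem exists_separated_of_not_isMontel {X : SF} (hX : ¬ IsMontel X) :
    ∃ (y : ℕ → CR) (M : ℕ → ℝ) (R : ℝ), (∀ n, y n ∈ (X : Submodule ℝ CR)) ∧
      (∀ (n k : ℕ) (x : ℝ), |x| ≤ k → |y n x| ≤ M k) ∧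
      ∀ m n : ℕ, m < n → ∃ x : ℝ, |x| ≤ R ∧ 1 ≤ |y m x - y n x| := by
  unfold IsMontel at hX
  push Not at hX
  obtain ⟨s, hs, hb, hc⟩ := hX
  have hs' : IsClosed (Subtype.val '' s : Set CR) :=
    (IsClosed.isClosedEmbedding_subtypeVal X.2).isClosedMap _ hs
  have hb' : Bornology.IsVonNBounded ℝ (Subtype.val '' s : Set CR) :=
    hb.image (X : Submodule ℝ CR).subtypeL
  have hc' : ¬ TotallyBounded (Subtype.val '' s : Set CR) := fun h =>
    hc (Subtype.isCompact_iff.2 (isCompact_iff_totallyBounded_isComplete.2 ⟨h, hs'.isComplete⟩))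
  obtain ⟨M, hM⟩ := exists_bound_of_isVonNBounded hb'
  obtain ⟨u, R, ε, hε, hu, hsep⟩ := exists_separated_seq_of_not_totallyBounded hc'
  refine ⟨fun n => ε⁻¹ • u n, fun k => ε⁻¹ * M k, R, fun n => ?_, fun n k x hx => ?_,
    fun m n hmn => ?_⟩
  · obtain ⟨f, -, hf⟩ := hu n
    exact Submodule.smul_mem _ _ (hf ▸ f.2)
  · simp only [ContinuousMap.smul_apply, smul_eq_mul, abs_mul, abs_of_pos (inv_pos.2 hε)]
    exact mul_le_mul_of_nonneg_left (hM _ (hu n) k x hx) (inv_pos.2 hε).le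
  · obtain ⟨x, hx, h⟩ := hsep m n hmn
    refine ⟨x, hx, ?_⟩
    simp only [ContinuousMap.smul_apply, smul_eq_mul, ← mul_sub, abs_mul,
      abs_of_pos (inv_pos.2 hε)]
    rwa [← div_eq_inv_mul, one_le_div hε]

theorem exists_seq_dense_in_submodule (p : Submodule ℝ CR) :
    ∃ d : ℕ → CR, (∀ n, d n ∈ p) ∧ (p : Set CR) ⊆ closure (range d) := by
  have : SecondCountableTopology p := IsEmbedding.subtypeVal.secondCountableTopology
  refine ⟨fun n => (TopologicalSpace.denseSeq p n : CR), fun n => (TopologicalSpace.denseSeq p n).2,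
    fun g hg => ?_⟩
  have h := image_closure_subset_closure_image (continuous_subtype_val (p := (· ∈ p)))
    (mem_image_of_mem _ (TopologicalSpace.denseRange_denseSeq p ⟨g, hg⟩))
  rwa [← range_comp] at h

/-- `Mon = {X ∈ SF : X is Montel}` is a coanalytic subset of `SF`. -/
theorem Mon_coanalytic : IsAnalyticIn Monᶜ := by
  refine ⟨separatedWitnesses, inferInstance, isClosed_separatedWitnesses.polishSpace,
    fun z => closedSpan z.1.1, ?_, ?_⟩
  · borelize ↥separatedWitnesses
    refine measurable_generateFrom ?_
    rintro _ ⟨U, hU, rfl⟩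
    exact ((isOpen_closedSpan_inter_nonempty hU).preimage
      (continuous_fst.comp continuous_subtype_val)).measurableSet
  · ext X
    constructor
    · rintro ⟨⟨⟨w, M, t, R⟩, hM, hR⟩, rfl⟩
      exact not_isMontel_of_separated (fun n => mem_closedSpan w (.inl n)) hM
        fun m n hmn => ⟨t m n, hR m n hmn⟩
    · intro hX
      obtain ⟨y, M, R, hy, hM, hsep⟩ := exists_separated_of_not_isMontel hX
      obtain ⟨d, hd, hdense⟩ := exists_seq_dense_in_submodule (X : Submodule ℝ CR)
      have ht : ∀ m n : ℕ, ∃ x : ℝ, m < n → |x| ≤ R ∧ 1 ≤ |y m x - y n x| := fun m n => by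
        by_cases hmn : m < n
        · obtain ⟨x, hx⟩ := hsep m n hmn
          exact ⟨x, fun _ => hx⟩
        · exact ⟨0, fun h => absurd h hmn⟩
      choose t ht using ht
      refine ⟨⟨(Sum.elim y d, M, t, R), hM, ht⟩, closedSpan_eq_of_dense ?_ ?_⟩
      · rintro (n | n)
        exacts [hy n, hd n]
      · refine hdense.trans (closure_mono ?_)
        rintro _ ⟨n, rfl⟩
        exact ⟨.inr n, rfl⟩
end
end

section
/- The set SB_F = {X ∈ SF : X is normable} is a Borel subset of the standard Borel space SF, where X is normable if there exists a norm on X generating its subspace topology. -/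
open MeasureTheory Set Topology

noncomputable section

/-- `X ∈ SF` is normable if there is a norm on `X` (a definite seminorm) generating
its subspace topology. -/
def IsNormable (X : SF) : Prop :=
  ∃ n : Seminorm ℝ ↥(X : Submodule ℝ CR),
    (∀ x, n x = 0 → x = 0) ∧ WithSeminorms (fun _ : Fin 1 => n)

/-- A space whose topology is defined by the family of seminorms `p` is normable iff finitely many
of them dominate all the others. -/
theorem WithSeminorms.exists_norm_iff {E ι : Type*} [AddCommGroup E] [Module ℝ E]
    [TopologicalSpace E] [T1Space E] {p : SeminormFamily ℝ E ι} (hp : WithSeminorms p) :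
    (∃ n : Seminorm ℝ E, (∀ x, n x = 0 → x = 0) ∧ WithSeminorms (fun _ : Fin 1 => n)) ↔
      ∃ s : Finset ι, ∀ i, ∃ C : ℕ, ∀ x, p i x ≤ C * s.sup p x := by
  constructor
  · rintro ⟨n, -, hn⟩
    obtain ⟨s, C, -, hC⟩ := Seminorm.bound_of_continuous hp n (hn.continuous_seminorm 0)
    refine ⟨s, fun i => ?_⟩
    obtain ⟨t, D, -, hD⟩ := Seminorm.bound_of_continuous hn (p i) (hp.continuous_seminorm i)
    obtain ⟨N, hN⟩ := exists_nat_ge (D * C : ℝ)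
    refine ⟨N, fun x => ?_⟩
    have ht : t.sup (fun _ => n) ≤ n := Finset.sup_le fun _ _ => le_rfl
    calc p i x ≤ D * t.sup (fun _ => n) x := hD x
      _ ≤ D * (C * s.sup p x) := by
          gcongr
          exact (ht x).trans (hC x)
      _ = (D * C) * s.sup p x := by ring
      _ ≤ N * s.sup p x := by gcongr
  · rintro ⟨s, hs⟩
    have hb (i : ι) : ∃ C : ℕ, p i ≤ (C : NNReal) • s.sup p := by
      obtain ⟨C, hC⟩ := hs i
      exact ⟨C, fun x => by simpa [NNReal.smul_def] using hC x⟩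
    refine ⟨s.sup p, fun x hx => ?_, hp.congr (fun _ => ⟨s, 1, by simp⟩) fun i => ?_⟩
    · by_contra hne
      obtain ⟨i, hi⟩ := hp.separating_of_T1 x hne
      obtain ⟨C, hC⟩ := hs i
      exact hi (le_antisymm (by simpa [hx] using hC x) (apply_nonneg _ _))
    · obtain ⟨C, hC⟩ := hb i
      exact ⟨{0}, C, by simpa using hC⟩

/-- The seminorms `f ↦ sup_{K n} |f|` on `C(X, ℝ)` attached to a compact exhaustion `K`. -/
def CompactExhaustion.supSeminorm {X : Type*} [TopologicalSpace X] (K : CompactExhaustion X) :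
    SeminormFamily ℝ C(X, ℝ) ℕ := fun n =>
  haveI : CompactSpace (K n) := isCompact_iff_compactSpace.mp (K.isCompact n)
  (normSeminorm ℝ C(K n, ℝ)).comp
    (ContinuousMap.compRightAlgHom ℝ ℝ ⟨Subtype.val, continuous_subtype_val⟩ :
      C(X, ℝ) →ₐ[ℝ] C(K n, ℝ)).toLinearMap

theorem CompactExhaustion.withSeminorms_supSeminorm {X : Type*} [TopologicalSpace X]
    (K : CompactExhaustion X) : WithSeminorms K.supSeminorm := by
  have comap_eq (n : ℕ) : (𝓝 (0 : ℝ)).comap (K.supSeminorm n) =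
      (𝓝 ((0 : C(X, ℝ)).restrict (K n))).comap (ContinuousMap.restrict (K n)) := by
    have : CompactSpace (K n) := isCompact_iff_compactSpace.mp (K.isCompact n)
    have h0 : (0 : C(X, ℝ)).restrict (K n) = 0 := rfl
    rw [h0, ← comap_norm_nhds_zero (E := C(K n, ℝ)), Filter.comap_comap]
    rfl
  rw [SeminormFamily.withSeminorms_iff_nhds_eq_iInf]
  simp_rw [comap_eq]
  refine le_antisymm (le_iInf fun n => ?_) ?_
  · exact ((ContinuousMap.continuous_restrict (K n)).tendsto 0).le_comap
  · rw [ContinuousMap.nhds_compactOpen_eq_iInf_nhds_induced]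
    refine le_iInf₂ fun s hs => ?_
    obtain ⟨n, hn⟩ := K.exists_superset_of_isCompact hs
    refine (iInf_le _ n).trans (Filter.tendsto_iff_comap.mp ?_)
    have hc : Continuous fun f : C(K n, ℝ) =>
        f.comp ⟨Set.inclusion hn, continuous_inclusion hn⟩ :=
      ContinuousMap.continuous_precomp _
    exact (hc.tendsto _).comp Filter.tendsto_comap

theorem SF.measurableSet_inter_nonempty {U : Set CR} (hU : IsOpen U) :
    MeasurableSet {X : SF | (((X : Submodule ℝ CR) : Set CR) ∩ U).Nonempty} :=
  MeasurableSpace.measurableSet_generateFrom ⟨U, hU, rfl⟩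

theorem SF.measurableSet_forall_mem {F : Set CR} (hF : IsClosed F) :
    MeasurableSet {X : SF | ∀ f ∈ (X : Submodule ℝ CR), f ∈ F} := by
  convert (SF.measurableSet_inter_nonempty hF.isOpen_compl).compl using 1
  ext X
  simp [Set.not_nonempty_iff_eq_empty, ← Set.disjoint_iff_inter_eq_empty,
    Set.disjoint_compl_right_iff_subset, Set.subset_def]

theorem isNormable_iff {ι : Type*} {p : SeminormFamily ℝ CR ι} (hp : WithSeminorms p) (X : SF) :
    IsNormable X ↔ ∃ s : Finset ι, ∀ i, ∃ C : ℕ, ∀ f ∈ (X : Submodule ℝ CR),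
      f ∈ {f : CR | p i f ≤ C * s.sup p f} := by
  have hX : WithSeminorms (p.comp (X : Submodule ℝ CR).subtype) :=
    (X : Submodule ℝ CR).subtype.withSeminorms_induced hp
  rw [IsNormable, hX.exists_norm_iff]
  simp [← SeminormFamily.finset_sup_comp, SeminormFamily.comp_apply]

/-- `SB_F = {X ∈ SF : X is normable}` is Borel in `SF`. -/
theorem normable_borel : MeasurableSet {X : SF | IsNormable X} := by
  have hp := (CompactExhaustion.choice ℝ).withSeminorms_supSeminorm
  simp_rw [isNormable_iff hp]
  rw [Set.ofPred_exists]
  refine .iUnion fun s => ?_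
  rw [Set.ofPred_forall]
  refine .iInter fun i => ?_
  rw [Set.ofPred_exists]
  exact .iUnion fun C => SF.measurableSet_forall_mem <|
    isClosed_le (hp.continuous_seminorm i)
      (continuous_const.mul (hp.finset_sups.continuous_seminorm s))
end
end

section
/- There exists a Borel injection Ψ : SB → SF such that Ψ(X) is linearly homeomorphic to X for every X ∈ SB; moreover Ψ can be taken to be a Borel isomorphism onto a Borel subset of SF. -/
open MeasureTheory Set Topology

noncomputable section

/-- The Cantor set. -/
abbrev Cantor : Type := ℕ → Bool

/-- `C(Δ)`: continuous real-valued functions on the Cantor set (with the sup norm,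
given by the compact-open topology since `Δ` is compact). -/
abbrev CDelta : Type := C(Cantor, ℝ)

/-- `SB`: the set of closed linear subspaces of `C(Δ)`. -/
def SB : Set (Submodule ℝ CDelta) := {p | IsClosed (p : Set CDelta)}

/-- The Effros Borel structure on `SB`. -/
instance : MeasurableSpace SB :=
  MeasurableSpace.generateFrom
    {A : Set SB | ∃ U : Set CDelta, IsOpen U ∧
      A = {X : SB | (((X : Submodule ℝ CDelta) : Set CDelta) ∩ U).Nonempty}}

/-- A linear embedding split by a continuous linear retraction restricts to a linear
homeomorphism from any submodule onto its image. -/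
def ContinuousLinearMap.equivMapOfLeftInverse {E F : Type*} [AddCommGroup E] [Module ℝ E]
    [TopologicalSpace E] [AddCommGroup F] [Module ℝ F] [TopologicalSpace F]
    (j : E →L[ℝ] F) (r : F →L[ℝ] E) (h : Function.LeftInverse r j) (X : Submodule ℝ E) :
    X ≃L[ℝ] X.map (j : E →ₗ[ℝ] F) where
  toLinearEquiv := Submodule.equivMapOfInjective (j : E →ₗ[ℝ] F) h.injective X
  continuous_toFun := (j.continuous.comp continuous_subtype_val).subtype_mk _
  continuous_invFun := by
    rw [continuous_induced_rng]
    refine (r.continuous.comp continuous_subtype_val).congr fun y => ?_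
    obtain ⟨x, rfl⟩ :=
      (Submodule.equivMapOfInjective (j : E →ₗ[ℝ] F) h.injective X).surjective y
    change r (j x) = _
    rw [h]
    exact congrArg Subtype.val
      ((Submodule.equivMapOfInjective _ h.injective X).symm_apply_apply x).symm

namespace LinearExtension

variable {K : Type*} (e : K → ℝ) (a : ℕ → K)

/-- The weight of the `n`-th sample point in the extension at `x`. -/
def weight (n : ℕ) (x : ℝ) : ℝ :=
  (1 / 2) ^ n * min 1 (max 0 (2 * Metric.infDist x (range e) - |x - e (a n)|))

lemma weight_nonneg (n : ℕ) (x : ℝ) : 0 ≤ weight e a n x := by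
  unfold weight; positivity

lemma weight_le (n : ℕ) (x : ℝ) : weight e a n x ≤ (1 / 2) ^ n :=
  mul_le_of_le_one_right (by positivity) (min_le_left _ _)

lemma continuous_weight (n : ℕ) : Continuous (weight e a n) := by
  have := Metric.continuous_infDist_pt (range e)
  unfold weight; fun_prop

lemma dist_lt_of_weight_ne_zero {n : ℕ} {x : ℝ} (h : weight e a n x ≠ 0) :
    |x - e (a n)| < 2 * Metric.infDist x (range e) := by
  by_contra! hx
  apply h
  rw [weight, max_eq_left (by linarith)]
  simp

lemma summable_weight (x : ℝ) : Summable fun n => weight e a n x :=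
  Summable.of_nonneg_of_le (weight_nonneg e a · x) (weight_le e a · x) summable_geometric_two

variable [TopologicalSpace K]

open Classical in
/-- The Dugundji-type extension of `f` along `e`: off the range of `e` it is a weighted average
of values of `f` at sample points close to `x`. -/
def extend (f : C(K, ℝ)) (x : ℝ) : ℝ :=
  if h : x ∈ range e then f h.choose
  else (∑' n, weight e a n x * f (a n)) / ∑' n, weight e a n x

lemma extend_apply (he : Function.Injective e) (f : C(K, ℝ)) (k : K) :
    extend e a f (e k) = f k := by
  have h : e k ∈ range e := mem_range_self k
  rw [extend, dif_pos h, he h.choose_spec]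

lemma extend_of_notMem (f : C(K, ℝ)) {x : ℝ} (hx : x ∉ range e) :
    extend e a f x = (∑' n, weight e a n x * f (a n)) / ∑' n, weight e a n x :=
  dif_neg hx

lemma extend_smul (c : ℝ) (f : C(K, ℝ)) (x : ℝ) :
    extend e a (c • f) x = c * extend e a f x := by
  by_cases h : x ∈ range e
  · simp [extend, h]
  · simp only [extend_of_notMem e a _ h, ContinuousMap.smul_apply, smul_eq_mul,
      mul_left_comm _ c, tsum_mul_left, mul_div_assoc]

variable [CompactSpace K]

lemma abs_weight_mul_le (f : C(K, ℝ)) (n : ℕ) (x : ℝ) :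
    ‖weight e a n x * f (a n)‖ ≤ (1 / 2) ^ n * ‖f‖ := by
  rw [norm_mul, Real.norm_of_nonneg (weight_nonneg e a n x)]
  exact mul_le_mul (weight_le e a n x) (f.norm_coe_le_norm _) (norm_nonneg _) (by positivity)

lemma summable_weight_mul (f : C(K, ℝ)) (x : ℝ) :
    Summable fun n => weight e a n x * f (a n) :=
  Summable.of_norm_bounded (summable_geometric_two.mul_right _) (abs_weight_mul_le e a f · x)

lemma tsum_weight_pos [Nonempty K] (he : Continuous e) (ha : DenseRange a) {x : ℝ}
    (hx : x ∉ range e) : 0 < ∑' n, weight e a n x := by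
  have hd : 0 < Metric.infDist x (range e) :=
    ((isCompact_range he).isClosed.notMem_iff_infDist_pos (range_nonempty e)).1 hx
  obtain ⟨_, ⟨k, rfl⟩, hk⟩ := (Metric.infDist_lt_iff (range_nonempty e)
    (r := 2 * Metric.infDist x (range e))).1 (by linarith)
  obtain ⟨n, hn⟩ := ha.exists_mem_open
    (isOpen_lt (continuous_const.dist he) continuous_const) ⟨k, hk⟩
  refine (summable_weight e a x).tsum_pos (weight_nonneg e a · x) n ?_
  have hn' : |x - e (a n)| < 2 * Metric.infDist x (range e) := hn
  unfold weight
  have : 0 < max 0 (2 * Metric.infDist x (range e) - |x - e (a n)|) :=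
    lt_max_of_lt_right (by linarith)
  positivity

lemma extend_add (f g : C(K, ℝ)) (x : ℝ) :
    extend e a (f + g) x = extend e a f x + extend e a g x := by
  by_cases h : x ∈ range e
  · simp [extend, h]
  · simp only [extend_of_notMem e a _ h, ContinuousMap.add_apply, mul_add]
    rw [(summable_weight_mul e a f x).tsum_add (summable_weight_mul e a g x), add_div]

/-- Off the range of `e`, the extension stays near `c` if the relevant samples are near `c`. -/
lemma abs_extend_sub_le [Nonempty K] (he : Continuous e) (ha : DenseRange a) (f : C(K, ℝ))
    {x c ε : ℝ} (hx : x ∉ range e)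
    (h : ∀ k, |x - e k| < 2 * Metric.infDist x (range e) → |f k - c| ≤ ε) :
    |extend e a f x - c| ≤ ε := by
  have hW := tsum_weight_pos e a he ha hx
  have hs := summable_weight e a x
  have hf := summable_weight_mul e a f x
  have key (n : ℕ) : |weight e a n x * f (a n) - weight e a n x * c| ≤ weight e a n x * ε := by
    rw [← mul_sub, abs_mul, abs_of_nonneg (weight_nonneg e a n x)]
    by_cases h0 : weight e a n x = 0
    · simp [h0]
    · exact mul_le_mul_of_nonneg_left (h _ (dist_lt_of_weight_ne_zero e a h0))
        (weight_nonneg e a n x)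
  rw [extend_of_notMem e a f hx, div_sub' hW.ne', abs_div, abs_of_pos hW, div_le_iff₀ hW,
    ← tsum_mul_right, ← hf.tsum_sub (hs.mul_right c), mul_comm ε, ← tsum_mul_right]
  exact tsum_of_norm_bounded (hs.mul_right ε).hasSum fun n => (Real.norm_eq_abs _).trans_le (key n)

lemma abs_extend_le [Nonempty K] (he : Continuous e) (ha : DenseRange a) (f : C(K, ℝ)) (x : ℝ) :
    |extend e a f x| ≤ ‖f‖ := by
  by_cases h : x ∈ range e
  · rw [extend, dif_pos h]
    exact f.norm_coe_le_norm _
  · simpa using abs_extend_sub_le e a he ha f (c := 0) h fun k _ => by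
      simpa using f.norm_coe_le_norm k

lemma continuous_extend [Nonempty K] (he : IsEmbedding e) (ha : DenseRange a)
    (f : C(K, ℝ)) : Continuous (extend e a f) := by
  rw [continuous_iff_continuousAt]
  intro x
  by_cases hx : x ∈ range e
  · obtain ⟨k, rfl⟩ := hx
    rw [Metric.continuousAt_iff]
    intro ε hε
    obtain ⟨δ, hδ, hf⟩ : ∃ δ > 0, ∀ q, |e q - e k| < δ → |f q - f k| < ε / 2 := by
      have h1 := f.continuous.continuousAt (x := k) (Metric.ball_mem_nhds (f k) (half_pos hε))
      rw [Filter.mem_map, he.nhds_eq_comap, Filter.mem_comap] at h1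
      obtain ⟨t, ht, hts⟩ := h1
      obtain ⟨δ, hδ, hb⟩ := Metric.mem_nhds_iff.1 ht
      exact ⟨δ, hδ, fun q hq => hts (hb hq)⟩
    refine ⟨δ / 3, by positivity, fun {y} hy => ?_⟩
    rw [extend_apply e a he.injective, Real.dist_eq]
    rw [Real.dist_eq] at hy
    by_cases hy' : y ∈ range e
    · obtain ⟨q, rfl⟩ := hy'
      rw [extend_apply e a he.injective]
      linarith [hf q (by linarith)]
    · have h2 : Metric.infDist y (range e) ≤ |y - e k| :=
        Metric.infDist_le_dist_of_mem (mem_range_self k)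
      refine (abs_extend_sub_le e a he.continuous ha f (ε := ε / 2) hy' fun q hq =>
        (hf q ?_).le).trans_lt (by linarith)
      have h3 := abs_sub_le (e q) y (e k)
      rw [abs_sub_comm (e q) y] at h3
      linarith
  · have hW := tsum_weight_pos e a he.continuous ha hx
    have hc : ContinuousAt (fun y => (∑' n, weight e a n y * f (a n)) / ∑' n, weight e a n y) x :=
      ContinuousAt.div
        (continuous_tsum (fun n => (continuous_weight e a n).mul continuous_const)
          (summable_geometric_two.mul_right ‖f‖) (abs_weight_mul_le e a f)).continuousAt
        (continuous_tsum (continuous_weight e a) summable_geometric_two fun n y => by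
          rw [Real.norm_of_nonneg (weight_nonneg e a n y)]
          exact weight_le e a n y).continuousAt hW.ne'
    refine hc.congr ?_
    filter_upwards [(isCompact_range he.continuous).isClosed.isOpen_compl.mem_nhds hx] with y hy
    exact (extend_of_notMem e a f hy).symm

/-- The extension operator as a continuous linear map. -/
def extendCLM [Nonempty K] (he : IsEmbedding e) (ha : DenseRange a) : C(K, ℝ) →L[ℝ] C(ℝ, ℝ) where
  toFun f := ⟨extend e a f, continuous_extend e a he ha f⟩
  map_add' f g := ContinuousMap.ext (extend_add e a f g)
  map_smul' c f := ContinuousMap.ext (extend_smul e a c f)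
  cont := by
    refine ContinuousMap.continuous_of_continuous_uncurry _ ?_
    refine continuous_prod_of_continuous_lipschitzWith _ 1
      (fun f => continuous_extend e a he ha f) fun x => ?_
    refine LipschitzWith.of_dist_le_mul fun f g => ?_
    have h1 := extend_add e a (f - g) g x
    have h2 := abs_extend_le e a he.continuous ha (f - g) x
    rw [sub_add_cancel] at h1
    simpa [Real.dist_eq, dist_eq_norm, h1] using h2

end LinearExtension

/-- `C(Δ)` embeds in `C(ℝ)` as a subspace that is the range of a continuous projection. -/
lemma exists_leftInverse_CDelta_CR :
    ∃ (j : CDelta →L[ℝ] CR) (r : CR →L[ℝ] CDelta), Function.LeftInverse r j := by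
  let e : Cantor → ℝ := fun x => cantorSetHomeomorphNatToBool.symm x
  have he : IsEmbedding e :=
    IsEmbedding.subtypeVal.comp cantorSetHomeomorphNatToBool.symm.isEmbedding
  refine ⟨LinearExtension.extendCLM e _ he (TopologicalSpace.denseRange_denseSeq Cantor),
    { toFun := fun g => g.comp ⟨e, he.continuous⟩
      map_add' := fun _ _ => rfl
      map_smul' := fun _ _ => rfl
      cont := ContinuousMap.continuous_precomp _ }, fun f => ?_⟩
  ext x
  exact LinearExtension.extend_apply e _ he.injective f x

/-- There exists a Borel injection `Ψ : SB → SF` with `Ψ X` linearly homeomorphic to `X`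
for all `X ∈ SB`; moreover `Ψ` may be taken to be a Borel isomorphism onto a Borel
subset of `SF` (its range is Borel and `Ψ` maps Borel sets to Borel sets). -/
theorem exists_borel_embedding_SB_SF :
    ∃ Ψ : SB → SF, Measurable Ψ ∧ Function.Injective Ψ ∧
      (∀ X : SB, Nonempty (↥(X : Submodule ℝ CDelta) ≃L[ℝ] ↥((Ψ X : Submodule ℝ CR)))) ∧
      MeasurableSet (Set.range Ψ) ∧
      (∀ A : Set SB, MeasurableSet A → MeasurableSet (Ψ '' A)) := by
  obtain ⟨j, r, hrj⟩ := exists_leftInverse_CDelta_CR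
  have hcl : IsClosedEmbedding j := hrj.isClosedEmbedding r.continuous j.continuous
  let Ψ : SB → SF := fun X =>
    ⟨(X : Submodule ℝ CDelta).map (j : CDelta →ₗ[ℝ] CR), by
      change IsClosed (((X : Submodule ℝ CDelta).map (j : CDelta →ₗ[ℝ] CR) :
        Submodule ℝ CR) : Set CR)
      rw [Submodule.map_coe]
      exact hcl.isClosedMap _ X.2⟩
  have hmem (X : SB) (y : CR) :
      y ∈ (Ψ X : Submodule ℝ CR) ↔ ∃ x ∈ (X : Submodule ℝ CDelta), j x = y :=
    Submodule.mem_map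
  have hinj : Function.Injective Ψ := fun X Y h =>
    Subtype.ext (Submodule.map_injective_of_injective (f := (j : CDelta →ₗ[ℝ] CR))
      hrj.injective (congrArg Subtype.val h))
  have hrange : MeasurableSet (range Ψ) := by
    have hU : MeasurableSet {Y : SF | (((Y : Submodule ℝ CR) : Set CR) ∩ (range j)ᶜ).Nonempty} :=
      MeasurableSpace.measurableSet_generateFrom
        ⟨_, hcl.isClosed_range.isOpen_compl, rfl⟩
    convert hU.compl using 1
    ext Y
    constructor
    · rintro ⟨X, rfl⟩ ⟨y, hy, hy'⟩
      obtain ⟨x, -, rfl⟩ := (hmem X y).1 hy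
      exact hy' (mem_range_self x)
    · intro h
      refine ⟨⟨(Y : Submodule ℝ CR).comap (j : CDelta →ₗ[ℝ] CR),
        (show IsClosed ((Y : Submodule ℝ CR) : Set CR) from Y.2).preimage j.continuous⟩,
        Subtype.ext (Submodule.ext fun y => (hmem _ y).trans ⟨?_, fun hy => ?_⟩)⟩
      · rintro ⟨x, hx, rfl⟩
        exact hx
      · by_cases hy' : y ∈ range j
        · obtain ⟨x, rfl⟩ := hy'
          exact ⟨x, hy, rfl⟩
        · exact (h ⟨y, hy, hy'⟩).elim
  refine ⟨Ψ, ?_, hinj, fun X => ⟨j.equivMapOfLeftInverse r hrj X⟩, hrange, fun A hA => ?_⟩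
  · refine measurable_generateFrom ?_
    rintro _ ⟨U, hU, rfl⟩
    refine MeasurableSpace.measurableSet_generateFrom ⟨j ⁻¹' U, hU.preimage j.continuous, ?_⟩
    ext X
    constructor
    · rintro ⟨y, hy, hyU⟩
      obtain ⟨x, hx, rfl⟩ := (hmem X y).1 hy
      exact ⟨x, hx, hyU⟩
    · rintro ⟨x, hx, hxU⟩
      exact ⟨j x, (hmem X _).2 ⟨x, hx, rfl⟩, hxU⟩
  · induction A, hA using MeasurableSpace.generateFrom_induction with
    | hC A hA _ =>
      obtain ⟨U, hU, rfl⟩ := hA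
      have hV : MeasurableSet {Y : SF | (((Y : Submodule ℝ CR) : Set CR) ∩ r ⁻¹' U).Nonempty} :=
        MeasurableSpace.measurableSet_generateFrom ⟨_, hU.preimage r.continuous, rfl⟩
      convert hrange.inter hV using 1
      ext Y
      constructor
      · rintro ⟨X, ⟨x, hx, hxU⟩, rfl⟩
        refine ⟨mem_range_self X, j x, (hmem X _).2 ⟨x, hx, rfl⟩, ?_⟩
        rwa [mem_preimage, hrj]
      · rintro ⟨⟨X, rfl⟩, y, hy, hyU⟩
        obtain ⟨x, hx, rfl⟩ := (hmem X y).1 hy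
        rw [mem_preimage, hrj] at hyU
        exact ⟨X, ⟨x, hx, hyU⟩, rfl⟩
    | empty => simp
    | compl A _ ih =>
      rw [image_compl_eq_range_sdiff_image hinj]
      exact hrange.diff ih
    | iUnion s _ ih =>
      rw [image_iUnion]
      exact MeasurableSet.iUnion ih
end
end

section
/- The set Sch = {X ∈ SF : X is a Schwartz space} is a Borel subset of SF. -/
open MeasureTheory Set Topology

noncomputable section

/-- `K` is totally bounded with respect to `U`: for every `ε > 0`, `K` is covered by
finitely many translates of `ε • U`. -/
def TotallyBoundedWrt {E : Type} [AddCommGroup E] [Module ℝ E] (K U : Set E) : Prop :=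
  ∀ ε : ℝ, 0 < ε → ∃ (m : ℕ) (x : Fin m → E),
    K ⊆ ⋃ i : Fin m, (fun u => x i + ε • u) '' U

/-- `X ∈ SF` is a Schwartz space: every neighborhood of `0` admits a neighborhood of `0`
totally bounded with respect to it. -/
def IsSchwartz (X : SF) : Prop :=
  ∀ U ∈ 𝓝 (0 : ↥(X : Submodule ℝ CR)), ∃ V ∈ 𝓝 (0 : ↥(X : Submodule ℝ CR)),
    TotallyBoundedWrt V U

open scoped Pointwise

section Characterization

variable {E : Type} [AddCommGroup E] [Module ℝ E]

/-- A family of coverings of the trace of `A` on a subspace by translates of scalar multiples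
of `W`, with centers in the ambient space, yields total boundedness inside the subspace. -/
lemma totallyBoundedWrt_of_cover {p : Submodule ℝ E} {d : ℕ → E} {U : Set p} {A W B : Set E}
    (hWB : W - W ⊆ B) (hB : Balanced ℝ B) (hBU : Subtype.val ⁻¹' B ⊆ U)
    (h : ∀ k : ℕ, ∃ F : Finset ℕ,
      (p : Set E) ∩ A ⊆ ⋃ i ∈ F, (d i +ᵥ (1 / ((k : ℝ) + 1)) • W)) :
    TotallyBoundedWrt (Subtype.val ⁻¹' A : Set p) U := by
  classical
  intro ε hε
  obtain ⟨k, hk⟩ := exists_nat_one_div_lt hε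
  set δ : ℝ := 1 / ((k : ℝ) + 1) with hδ
  have hδ0 : 0 < δ := by positivity
  obtain ⟨F, hF⟩ := h k
  have key : ∀ i : ℕ, ∃ x : p, (∃ y : p, (y : E) ∈ d i +ᵥ δ • W) → (x : E) ∈ d i +ᵥ δ • W := by
    intro i
    by_cases hi : ∃ y : p, (y : E) ∈ d i +ᵥ δ • W
    · exact ⟨hi.choose, fun _ => hi.choose_spec⟩
    · exact ⟨0, fun h => absurd h hi⟩
  choose x hx using key
  refine ⟨F.card, fun j => x (F.equivFin.symm j), ?_⟩
  intro y hy
  obtain ⟨i, hi, hyi⟩ := mem_iUnion₂.1 (hF ⟨y.2, hy⟩)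
  obtain ⟨_, ⟨w, hw, rfl⟩, hwy⟩ := hyi
  obtain ⟨_, ⟨v, hv, rfl⟩, hvx⟩ := hx i ⟨y, _, ⟨w, hw, rfl⟩, hwy⟩
  simp only [vadd_eq_add] at hwy hvx
  refine mem_iUnion.2 ⟨F.equivFin ⟨i, hi⟩, ε⁻¹ • (y - x i), hBU ?_, ?_⟩
  · have h1 : (y : E) - x i ∈ δ • B := by
      rw [← hwy, ← hvx, add_sub_add_left_eq_sub, ← smul_sub]
      exact smul_mem_smul_set (hWB (sub_mem_sub hw hv))
    have h2 : (y : E) - x i ∈ ε • B :=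
      hB.smul_mono (by rw [Real.norm_of_nonneg hδ0.le, Real.norm_of_nonneg hε.le]; exact hk.le) h1
    exact (mem_smul_set_iff_inv_smul_mem₀ hε.ne' B ((y : E) - x i)).1 h2
  · simp [smul_inv_smul₀ hε.ne']

variable [TopologicalSpace E] [IsTopologicalAddGroup E] [ContinuousSMul ℝ E]

/-- The trace on a subspace of a neighborhood of `0` which is totally bounded with respect to
another one can be covered by translates whose centers come from a dense sequence of the
ambient space. -/
lemma TotallyBoundedWrt.exists_finset_dense {p : Submodule ℝ E} {d : ℕ → E} (hd : DenseRange d)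
    {V : Set p} {A B W : Set E} (hAV : Subtype.val ⁻¹' A ⊆ V) (hB : B ∈ 𝓝 (0 : E))
    (hBW : B + B ⊆ W) (h : TotallyBoundedWrt V (Subtype.val ⁻¹' B : Set p)) {ε : ℝ}
    (hε : 0 < ε) :
    ∃ F : Finset ℕ, (p : Set E) ∩ A ⊆ ⋃ i ∈ F, (d i +ᵥ ε • W) := by
  classical
  obtain ⟨m, x, hx⟩ := h ε hε
  have key : ∀ y : E, ∃ k, y - d k ∈ ε • B := by
    intro y
    have hs : ε • B ∈ 𝓝 (0 : E) := (set_smul_mem_nhds_zero_iff hε.ne').2 hB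
    have ht : Filter.Tendsto (fun z : E => y - z) (𝓝 y) (𝓝 0) := by
      have : Continuous fun z : E => y - z := by fun_prop
      simpa using this.tendsto y
    exact hd.mem_nhds (ht hs)
  choose k hk using key
  refine ⟨Finset.univ.image fun i => k (x i), ?_⟩
  rintro y ⟨hyp, hyA⟩
  obtain ⟨i, u, hu, hxu⟩ := mem_iUnion.1 (hx (hAV (show (⟨y, hyp⟩ : p) ∈ _ from hyA)))
  refine mem_biUnion (x := k (x i)) (by simp) ?_
  obtain ⟨b, hb, hbx⟩ := mem_smul_set.1 (hk (x i))
  rw [mem_vadd_set]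
  refine ⟨ε • (b + u), smul_mem_smul_set (hBW (add_mem_add hb hu)), ?_⟩
  have hxu' : (x i : E) + ε • (u : E) = y := congrArg Subtype.val hxu
  rw [smul_add, hbx, ← hxu', vadd_eq_add]
  abel

/-- Being a Schwartz space, for a subspace, in terms of a countable basis of neighborhoods of `0`
and a dense sequence of the ambient space. -/
lemma forall_exists_totallyBoundedWrt_iff {W : ℕ → Set E} (hW : (𝓝 (0 : E)).HasAntitoneBasis W)
    {d : ℕ → E} (hd : DenseRange d) (p : Submodule ℝ E) :
    (∀ U ∈ 𝓝 (0 : p), ∃ V ∈ 𝓝 (0 : p), TotallyBoundedWrt V U) ↔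
      ∀ n, ∃ m, ∀ k : ℕ, ∃ F : Finset ℕ,
        (p : Set E) ∩ interior (W m) ⊆ ⋃ i ∈ F, (d i +ᵥ (1 / ((k : ℝ) + 1)) • W n) := by
  have hnhds : 𝓝 (0 : p) = Filter.comap Subtype.val (𝓝 (0 : E)) := nhds_subtype_eq_comap
  constructor
  · intro h n
    obtain ⟨B, hB, hBW⟩ : ∃ B ∈ 𝓝 (0 : E), B + B ⊆ W n := by
      obtain ⟨B, hBo, hB0, hBW⟩ := exists_open_nhds_zero_add_subset (hW.mem n)
      exact ⟨B, hBo.mem_nhds hB0, hBW⟩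
    obtain ⟨V, hV, hVB⟩ := h (Subtype.val ⁻¹' B) (hnhds ▸ Filter.preimage_mem_comap hB)
    rw [hnhds] at hV
    obtain ⟨t, ht, htV⟩ := hV
    obtain ⟨m, hm⟩ := hW.mem_iff.1 ht
    refine ⟨m, fun k => hVB.exists_finset_dense hd ?_ hB hBW (by positivity)⟩
    exact (preimage_mono (interior_subset.trans hm)).trans htV
  · intro h U hU
    rw [hnhds] at hU
    obtain ⟨t, ht, htU⟩ := hU
    obtain ⟨B, ⟨hB, hBb⟩, hBt⟩ := (nhds_basis_balanced ℝ E).mem_iff.1 ht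
    obtain ⟨S, hS, hSB⟩ := exists_nhds_half_neg hB
    obtain ⟨n, hn⟩ := hW.mem_iff.1 hS
    obtain ⟨m, hm⟩ := h n
    refine ⟨Subtype.val ⁻¹' interior (W m),
      hnhds ▸ Filter.preimage_mem_comap (interior_mem_nhds.2 (hW.mem m)),
      totallyBoundedWrt_of_cover ?_ hBb ((preimage_mono hBt).trans htU) hm⟩
    rintro _ ⟨a, ha, b, hb, rfl⟩
    exact hSB a (hn ha) b (hn hb)

end Characterization

lemma measurableSet_inter_open_subset_closed {A C : Set CR} (hA : IsOpen A) (hC : IsClosed C) :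
    MeasurableSet {X : SF | ((X : Submodule ℝ CR) : Set CR) ∩ A ⊆ C} := by
  have h : MeasurableSet {X : SF | (((X : Submodule ℝ CR) : Set CR) ∩ (A \ C)).Nonempty} :=
    MeasurableSpace.measurableSet_generateFrom ⟨A \ C, hA.sdiff hC, rfl⟩
  convert h.compl using 1
  ext X
  simp only [mem_ofPred_eq, mem_compl_iff, not_nonempty_iff_eq_empty]
  rw [← inter_sdiff_assoc, sdiff_eq_empty]

/-- `Sch = {X ∈ SF : X is Schwartz}` is Borel in `SF`. -/
theorem schwartz_borel : MeasurableSet {X : SF | IsSchwartz X} := by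
  obtain ⟨W, hWc, hW⟩ := (closed_nhds_basis (0 : CR)).exists_antitone_subbasis
  have hset : {X : SF | IsSchwartz X} = ⋂ n, ⋃ m, ⋂ k : ℕ, ⋃ F : Finset ℕ,
      {X : SF | ((X : Submodule ℝ CR) : Set CR) ∩ interior (W m) ⊆
        ⋃ i ∈ F, (TopologicalSpace.denseSeq CR i +ᵥ (1 / ((k : ℝ) + 1)) • W n)} := by
    ext X
    simp only [mem_iInter, mem_iUnion, mem_ofPred_eq]
    exact forall_exists_totallyBoundedWrt_iff hW (TopologicalSpace.denseRange_denseSeq CR) X.1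
  rw [hset]
  refine .iInter fun n => .iUnion fun m => .iInter fun k => .iUnion fun F =>
    measurableSet_inter_open_subset_closed isOpen_interior
      (F.finite_toSet.isClosed_biUnion fun i _ => ?_)
  exact ((hWc n).2.smul_of_ne_zero (by positivity)).vadd _
end
end

section
/- Let K be the set of all matrices [a_{i,k}] ∈ ℕ^{ℕ×ℕ} such that a_{i,k} ≤ a_{i,k+1} for all i,k (Köthe matrices with natural number entries), and let MK ⊆ K be the set of those [a_{i,k}] such that for every infinite I ⊆ ℕ and every j ∈ ℕ there is k ∈ ℕ with inf_{i∈I} a_{i,j}/a_{i,k} = 0 (Montel–Köthe matrices). Then K is a Polish space (with the topology inherited from the product space ℕ^{ℕ×ℕ}) and MK is a complete coanalytic subset of K: MK is coanalytic, and for every Polish space Z and every coanalytic B ⊆ Z there is a Borel map f : Z → K with f⁻¹(MK) = B. -/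
open Set Topology

noncomputable section

/-- `ℕ`-by-`ℕ` matrices of natural numbers, with the (Polish) product topology. -/
abbrev NMat : Type := (ℕ × ℕ) → ℕ

/-- Köthe matrices (with natural number entries): rows are nondecreasing in `k`. -/
def Kothe : Set NMat := {a | ∀ i k : ℕ, a (i, k) ≤ a (i, k + 1)}

/-- Montel–Köthe matrices: for every infinite `I ⊆ ℕ` and every `j` there is `k` with
`inf_{i ∈ I} a_{i,j} / a_{i,k} = 0`. -/
def IsMontelKothe (a : NMat) : Prop :=
  ∀ I : Set ℕ, I.Infinite → ∀ j : ℕ, ∃ k : ℕ,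
    sInf {r : ℝ | ∃ i ∈ I, r = (a (i, j) : ℝ) / (a (i, k) : ℝ)} = 0

def MK : Set ↥Kothe := {A | IsMontelKothe (A : NMat)}

instance : MeasurableSpace ↥Kothe := borel _
instance : BorelSpace ↥Kothe := ⟨rfl⟩

/-- A subset of a topological space is analytic if it is a continuous image of a
Polish space. -/
def IsAnalyticT {α : Type*} [TopologicalSpace α] (A : Set α) : Prop :=
  ∃ (Z : Type) (tZ : TopologicalSpace Z), @PolishSpace Z tZ ∧
    ∃ f : Z → α, @Continuous Z α tZ _ f ∧ Set.range f = A

/-- The infimum in the Montel condition fails to vanish exactly when column `k` is positive on `I`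
and dominated there by a multiple of column `j`. -/
lemma sInf_div_ne_zero_iff (a : NMat) {I : Set ℕ} (hI : I.Nonempty) (j k : ℕ) :
    sInf {r : ℝ | ∃ i ∈ I, r = (a (i, j) : ℝ) / (a (i, k) : ℝ)} ≠ 0 ↔
      ∃ C : ℕ, ∀ i ∈ I, 0 < a (i, k) ∧ a (i, k) ≤ C * a (i, j) := by
  set S := {r : ℝ | ∃ i ∈ I, r = (a (i, j) : ℝ) / (a (i, k) : ℝ)}
  have hS0 : ∀ r ∈ S, 0 ≤ r := by
    rintro r ⟨i, -, rfl⟩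
    positivity
  have hSn : S.Nonempty := hI.elim fun i hi => ⟨_, i, hi, rfl⟩
  constructor
  · intro h
    have hpos : 0 < sInf S := lt_of_le_of_ne (Real.sInf_nonneg hS0) h.symm
    obtain ⟨C, hC⟩ := exists_nat_ge (sInf S)⁻¹
    refine ⟨C, fun i hi => ?_⟩
    have hle : sInf S ≤ (a (i, j) : ℝ) / a (i, k) := csInf_le ⟨0, hS0⟩ ⟨i, hi, rfl⟩
    have hk : 0 < a (i, k) := by
      rcases Nat.eq_zero_or_pos (a (i, k)) with h0 | h0
      · simp only [h0, Nat.cast_zero, div_zero] at hle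
        linarith
      · exact h0
    refine ⟨hk, ?_⟩
    have hk' : (0 : ℝ) < a (i, k) := by exact_mod_cast hk
    have h1 : sInf S * a (i, k) ≤ a (i, j) := (le_div_iff₀ hk').1 hle
    have h2 : (a (i, k) : ℝ) ≤ (sInf S)⁻¹ * a (i, j) := by
      rwa [le_inv_mul_iff₀ hpos]
    have h3 : (a (i, k) : ℝ) ≤ C * a (i, j) :=
      h2.trans (mul_le_mul_of_nonneg_right hC (Nat.cast_nonneg _))
    exact_mod_cast h3
  · rintro ⟨C, hC⟩
    obtain ⟨i₀, hi₀⟩ := hI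
    have hC0 : 0 < C := by
      obtain ⟨h1, h2⟩ := hC i₀ hi₀
      exact Nat.pos_of_ne_zero fun h => by simp [h] at h2; omega
    have hC0' : (0 : ℝ) < C := by exact_mod_cast hC0
    refine ((inv_pos.2 hC0').trans_le (le_csInf hSn ?_)).ne'
    rintro r ⟨i, hi, rfl⟩
    obtain ⟨h1, h2⟩ := hC i hi
    have h1' : (0 : ℝ) < a (i, k) := by exact_mod_cast h1
    rw [le_div_iff₀ h1', inv_mul_le_iff₀ hC0']
    exact_mod_cast h2

lemma not_isMontelKothe_iff (a : NMat) :
    ¬ IsMontelKothe a ↔ ∃ I : Set ℕ, I.Infinite ∧ ∃ (j : ℕ) (C : ℕ → ℕ),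
      ∀ k, ∀ i ∈ I, 0 < a (i, k) ∧ a (i, k) ≤ C k * a (i, j) := by
  unfold IsMontelKothe
  push Not
  refine exists_congr fun I => and_congr_right fun hI => exists_congr fun j => ?_
  exact (forall_congr' fun k => sInf_div_ne_zero_iff a hI.nonempty j k).trans Classical.skolem

lemma isClosed_kothe : IsClosed Kothe := by
  simp only [Kothe, ofPred_forall]
  exact isClosed_iInter fun i => isClosed_iInter fun k =>
    isClosed_le (continuous_apply _) (continuous_apply _)

instance : PolishSpace ↥Kothe := isClosed_kothe.polishSpace

/-- Witnesses `(A, s, j, C)` that `A` is not a Montel–Köthe matrix. -/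
def nonMontelWitness : Set (↥Kothe × (ℕ → ℕ) × ℕ × (ℕ → ℕ)) :=
  {p | ∀ n, p.2.1 n < p.2.1 (n + 1) ∧ ∀ k, 0 < (p.1 : NMat) (p.2.1 n, k) ∧
    (p.1 : NMat) (p.2.1 n, k) ≤ p.2.2.2 k * (p.1 : NMat) (p.2.1 n, p.2.2.1)}

/-- Evaluation of a matrix is jointly continuous in the matrix and its (discrete) indices. -/
lemma continuous_matrix_apply {X : Type*} [TopologicalSpace X] {F : X → NMat} {u v : X → ℕ}
    (hF : Continuous F) (hu : Continuous u) (hv : Continuous v) :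
    Continuous fun x => F x (u x, v x) := by
  have hev : Continuous fun q : NMat × (ℕ × ℕ) => q.1 q.2 :=
    continuous_prod_of_discrete_right.2 fun p => continuous_apply p
  exact hev.comp (hF.prodMk (hu.prodMk hv))

lemma isClosed_nonMontelWitness : IsClosed nonMontelWitness := by
  have hA : Continuous fun p : ↥Kothe × (ℕ → ℕ) × ℕ × (ℕ → ℕ) => (p.1 : NMat) := by fun_prop
  have hs (n : ℕ) : Continuous fun p : ↥Kothe × (ℕ → ℕ) × ℕ × (ℕ → ℕ) => p.2.1 n := by fun_prop
  have hj : Continuous fun p : ↥Kothe × (ℕ → ℕ) × ℕ × (ℕ → ℕ) => p.2.2.1 := by fun_prop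
  have hC (k : ℕ) : Continuous fun p : ↥Kothe × (ℕ → ℕ) × ℕ × (ℕ → ℕ) => p.2.2.2 k := by fun_prop
  simp only [nonMontelWitness, ofPred_forall, ofPred_and, ← Nat.succ_le_iff]
  refine isClosed_iInter fun n => IsClosed.inter ?_ (isClosed_iInter fun k => IsClosed.inter ?_ ?_)
  · exact isClosed_le (continuous_of_discreteTopology.comp (hs n)) (hs (n + 1))
  · exact isClosed_le continuous_const (continuous_matrix_apply hA (hs n) continuous_const)
  · exact isClosed_le (continuous_matrix_apply hA (hs n) continuous_const)
      ((hC k).mul (continuous_matrix_apply hA (hs n) hj))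

lemma isAnalyticT_compl_MK : IsAnalyticT MKᶜ := by
  refine ⟨nonMontelWitness, inferInstance, isClosed_nonMontelWitness.polishSpace,
    fun p => p.1.1, by fun_prop, ?_⟩
  ext A
  change _ ↔ ¬ IsMontelKothe (A : NMat)
  rw [not_isMontelKothe_iff]
  constructor
  · rintro ⟨⟨⟨A, s, j, C⟩, h⟩, rfl⟩
    refine ⟨range s, infinite_range_of_injective
      (strictMono_nat_of_lt_succ fun n => (h n).1).injective, j, C, ?_⟩
    rintro k _ ⟨n, rfl⟩
    exact (h n).2 k
  · rintro ⟨I, hI, j, C, h⟩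
    exact ⟨⟨(A, Nat.nth (· ∈ I), j, C), fun n =>
      ⟨Nat.nth_strictMono hI n.lt_succ_self, fun k => h k _ (Nat.nth_mem_of_infinite hI n)⟩⟩, rfl⟩

/-- The sequences extending the finite sequence `s`. -/
def cylinderOf (s : List ℕ) : Set (ℕ → ℕ) := {y | ∀ m < s.length, s[m]? = some (y m)}

/-- The list coded by the natural number `i`. -/
abbrev node (i : ℕ) : List ℕ := Denumerable.ofNat (List ℕ) i

section Reduction

variable {Z : Type} [TopologicalSpace Z] (g : (ℕ → ℕ) → Z)

open Classical in
/-- The contribution of level `m` to the weight of row `i`; the rows whose node lies in the tree of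
approximations to `g ⁻¹' {z}` only see the length `m` prefix of their node. -/
def levelCode (z : Z) (i m : ℕ) : ℕ :=
  if z ∈ closure (g '' cylinderOf (node i)) then Encodable.encode ((node i).take m) else i

/-- The weight of the first `k` levels of row `i`. -/
def weight (z : Z) (i k : ℕ) : ℕ := 1 + ∑ m ∈ Finset.range k, levelCode g z i m

/-- The matrix assigned to the point `z`. -/
def treeMatrix (z : Z) : NMat := fun p => weight g z p.1 p.2 ^ p.2

variable {g}

lemma weight_mono (z : Z) (i : ℕ) : Monotone (weight g z i) := fun _ _ h =>
  Nat.add_le_add_left (Finset.sum_le_sum_of_subset (Finset.range_mono h)) 1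

lemma weight_pos (z : Z) (i k : ℕ) : 0 < weight g z i k := by
  unfold weight
  omega

lemma levelCode_le_weight (z : Z) (i m : ℕ) : levelCode g z i m ≤ weight g z i (m + 1) := by
  rw [weight, Finset.sum_range_succ]
  omega

lemma treeMatrix_mem_kothe (z : Z) : treeMatrix g z ∈ Kothe := fun i k =>
  (Nat.pow_le_pow_left (weight_mono z i k.le_succ) k).trans
    (Nat.pow_le_pow_right (weight_pos z i _) k.le_succ)

/-- Weights on a set of rows witnessing the failure of the Montel property are bounded. -/
lemma exists_weight_le {z : Z} {I : Set ℕ} {j : ℕ} {C : ℕ → ℕ}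
    (h : ∀ k, ∀ i ∈ I, treeMatrix g z (i, k) ≤ C k * treeMatrix g z (i, j)) (k : ℕ) :
    ∃ D, ∀ i ∈ I, weight g z i k ≤ D := by
  refine ⟨C (j + k + 1), fun i hi => (weight_mono z i (by omega : k ≤ j + k + 1)).trans ?_⟩
  have hk := h (j + k + 1) i hi
  simp only [treeMatrix] at hk
  set W := weight g z i (j + k + 1)
  have hW : 0 < W := weight_pos z i _
  have hj : weight g z i j ≤ W := weight_mono z i (by omega)
  have h1 : W * W ^ j ≤ C (j + k + 1) * W ^ j :=
    calc W * W ^ j = W ^ (j + 1) := by ring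
      _ ≤ W ^ (j + k + 1) := Nat.pow_le_pow_right hW (by omega)
      _ ≤ C (j + k + 1) * weight g z i j ^ j := hk
      _ ≤ C (j + k + 1) * W ^ j := Nat.mul_le_mul_left _ (Nat.pow_le_pow_left hj j)
  exact Nat.le_of_mul_le_mul_right h1 (pow_pos hW j)

/-- A point in the closure of the `g`-image of every neighbourhood of `x` equals `g x`. -/
lemma eq_of_forall_mem_closure [T2Space Z] (hg : Continuous g) {z : Z} {x : ℕ → ℕ}
    (h : ∀ n, z ∈ closure (g '' {y | ∀ m < n, y m = x m})) : z = g x := by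
  by_contra hne
  obtain ⟨U, V, hU, hV, hzU, hxV, hUV⟩ := t2_separation hne
  obtain ⟨n, hn⟩ : ∃ n, {y | ∀ m < n, y m = x m} ⊆ g ⁻¹' V := by
    obtain ⟨_, ⟨y, n, rfl⟩, hx, hsub⟩ := (PiNat.isTopologicalBasis_cylinders (fun _ : ℕ => ℕ)).mem_nhds_iff.1
      ((hV.preimage hg).mem_nhds hxV)
    exact ⟨n, (PiNat.mem_cylinder_iff_eq.1 hx ▸ hsub : PiNat.cylinder x n ⊆ _)⟩
  obtain ⟨_, hw, y, hy, rfl⟩ := mem_closure_iff.1 (h n) U hU hzU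
  exact hUV.le_bot ⟨hw, hn hy⟩

lemma not_isMontelKothe_treeMatrix (x : ℕ → ℕ) : ¬ IsMontelKothe (treeMatrix g (g x)) := by
  rw [not_isMontelKothe_iff]
  set p : ℕ → List ℕ := fun n => (List.range n).map x
  have hp : ∀ n, x ∈ cylinderOf (p n) := fun n m hm => by
    simp only [p, List.length_map, List.length_range] at hm
    simp [p, hm]
  have hcode : ∀ n m, levelCode g (g x) (Encodable.encode (p n)) m ≤
      ∑ l ∈ Finset.range (m + 1), Encodable.encode (p l) := fun n m => by
    have ht : (p n).take m = p (min m n) := by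
      simp [p, ← List.map_take, List.take_range]
    rw [levelCode, node, Denumerable.ofNat_encode,
      if_pos (subset_closure (mem_image_of_mem g (hp n))), ht]
    exact Finset.single_le_sum (f := fun l => Encodable.encode (p l)) (fun _ _ => Nat.zero_le _)
      (Finset.mem_range.2 (by omega))
  refine ⟨range fun n => Encodable.encode (p n), infinite_range_of_injective fun n n' h => ?_, 0,
    fun k => (1 + ∑ m ∈ Finset.range k, ∑ l ∈ Finset.range (m + 1), Encodable.encode (p l)) ^ k, ?_⟩
  · simpa [p] using congrArg List.length (Encodable.encode_injective h)
  · rintro k _ ⟨n, rfl⟩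
    refine ⟨pow_pos (weight_pos _ _ _) _, ?_⟩
    simp only [treeMatrix, pow_zero, mul_one]
    exact Nat.pow_le_pow_left (Nat.add_le_add_left (Finset.sum_le_sum fun m _ => hcode n m) 1) k

lemma mem_range_of_not_isMontelKothe [T2Space Z] (hg : Continuous g) {z : Z}
    (h : ¬ IsMontelKothe (treeMatrix g z)) : z ∈ range g := by
  obtain ⟨I, hI, j, C, hC⟩ := (not_isMontelKothe_iff _).1 h
  have hbdd : ∀ m, ∃ D, ∀ i ∈ I, levelCode g z i m ≤ D := fun m => by
    obtain ⟨D, hD⟩ := exists_weight_le (fun k i hi => (hC k i hi).2) (m + 1)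
    exact ⟨D, fun i hi => (levelCode_le_weight z i m).trans (hD i hi)⟩
  have : (Filter.cofinite ⊓ Filter.principal I).NeBot :=
    Filter.cofinite_inf_principal_neBot_iff.2 hI
  set U : Ultrafilter ℕ := Ultrafilter.of (Filter.cofinite ⊓ Filter.principal I)
  have hU : (U : Filter ℕ) ≤ Filter.cofinite ⊓ Filter.principal I := Ultrafilter.of_le _
  have hUI : ∀ᶠ i in U, i ∈ I := hU.trans inf_le_right (Filter.mem_principal_self I)
  have hUfin : ∀ S : Set ℕ, S.Finite → ∀ᶠ i in U, i ∉ S := fun S hS =>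
    hU.trans inf_le_left hS.compl_mem_cofinite
  have htree : ∀ᶠ i in U, z ∈ closure (g '' cylinderOf (node i)) := by
    obtain ⟨D, hD⟩ := hbdd 0
    filter_upwards [hUI, hUfin _ (finite_Iic D)] with i hi hiD
    by_contra hz
    have := hD i hi
    rw [levelCode, if_neg hz] at this
    exact hiD this
  have hlim : ∀ m, ∃ v, ∀ᶠ i in U, (node i)[m]? = some v := fun m => by
    obtain ⟨D, hD⟩ := hbdd (m + 1)
    have hfin : ∀ᶠ i in U, ∃ c ∈ Iic D, (node i).take (m + 1) = node c := by
      filter_upwards [hUI, htree] with i hi hz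
      have := hD i hi
      rw [levelCode, if_pos hz] at this
      exact ⟨_, this, (Denumerable.ofNat_encode _).symm⟩
    obtain ⟨c, -, hc⟩ := (Ultrafilter.eventually_exists_mem_iff (finite_Iic D)).1 hfin
    have hlen : m < (node c).length := by
      by_contra hlt
      obtain ⟨i, hi, hne⟩ := (hc.and (hUfin _ (finite_singleton c))).exists
      have hl := congrArg List.length hi
      rw [List.length_take] at hl
      rw [List.take_of_length_le (by omega)] at hi
      exact hne ((Denumerable.eqv (List ℕ)).symm.injective hi)
    refine ⟨(node c)[m], hc.mono fun i hi => ?_⟩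
    rw [← List.getElem?_take_of_lt m.lt_succ_self, hi, List.getElem?_eq_getElem hlen]
  choose x hx using hlim
  refine ⟨x, (eq_of_forall_mem_closure hg fun n => ?_).symm⟩
  have hall : ∀ᶠ i in U, ∀ m ∈ Iio n, (node i)[m]? = some (x m) :=
    (Filter.eventually_all_finite (finite_Iio n)).2 fun m _ => hx m
  obtain ⟨i, hz, hi⟩ := (htree.and hall).exists
  refine closure_mono (image_mono fun y hy m hm => ?_) hz
  have hm' := hi m hm
  obtain ⟨hlen, -⟩ := List.getElem?_eq_some_iff.1 hm'
  exact Option.some.inj ((hy m hlen).symm.trans hm')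

lemma measurable_treeMatrix [MeasurableSpace Z] [BorelSpace Z] :
    Measurable (treeMatrix g) := by
  refine measurable_pi_lambda _ fun p => Measurable.pow_const ?_ _
  refine measurable_const.add (Finset.measurable_sum _ fun m _ => ?_)
  exact Measurable.ite isClosed_closure.measurableSet measurable_const measurable_const

end Reduction

lemma exists_borel_reduction {Z : Type} [TopologicalSpace Z] [PolishSpace Z] [MeasurableSpace Z]
    [BorelSpace Z] {B : Set Z} (hB : IsAnalyticT Bᶜ) :
    ∃ f : Z → ↥Kothe, Measurable f ∧ f ⁻¹' MK = B := by
  have hval : MeasurableEmbedding (Subtype.val : ↥Kothe → NMat) :=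
    isClosed_kothe.isClosedEmbedding_subtypeVal.measurableEmbedding
  obtain ⟨Y, tY, hY, φ, hφ, hrange⟩ := hB
  rcases isEmpty_or_nonempty Y with hYe | hYn
  · refine ⟨fun _ => ⟨0, fun _ _ => le_rfl⟩, measurable_const, ?_⟩
    rw [range_eq_empty, eq_comm, compl_empty_iff] at hrange
    refine hrange.symm ▸ eq_univ_of_forall fun z => ?_
    by_contra h
    obtain ⟨I, hI, j, C, hC⟩ := (not_isMontelKothe_iff _).1 h
    obtain ⟨i, hi⟩ := hI.nonempty
    exact lt_irrefl 0 (hC 0 i hi).1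
  obtain ⟨ψ, hψ, hψs⟩ := PolishSpace.exists_nat_nat_continuous_surjective Y
  have hg : Continuous (φ ∘ ψ) := hφ.comp hψ
  have hgB : range (φ ∘ ψ) = Bᶜ := by rw [hψs.range_comp, hrange]
  refine ⟨fun z => ⟨treeMatrix (φ ∘ ψ) z, treeMatrix_mem_kothe z⟩,
    hval.measurable_comp_iff.1 measurable_treeMatrix, ?_⟩
  ext z
  rw [← not_iff_not, ← mem_compl_iff (s := B), ← hgB]
  refine ⟨fun h => mem_range_of_not_isMontelKothe hg h, ?_⟩
  rintro ⟨x, rfl⟩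
  exact not_isMontelKothe_treeMatrix x

/-- `K` is a Polish space and `MK` is a complete coanalytic subset of `K`: it is
coanalytic, and every coanalytic subset of a Polish space Borel-reduces to it. -/
theorem montelKothe_complete_coanalytic :
    PolishSpace ↥Kothe ∧
    IsAnalyticT MKᶜ ∧
    (∀ (Z : Type) [TopologicalSpace Z] [PolishSpace Z] [MeasurableSpace Z] [BorelSpace Z],
      ∀ B : Set Z, IsAnalyticT Bᶜ →
        ∃ f : Z → ↥Kothe, Measurable f ∧ f ⁻¹' MK = B) := by
  exact ⟨inferInstance, isAnalyticT_compl_MK, fun _ _ _ _ _ _ hB => exists_borel_reduction hB⟩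
end
end

section
/- Every infinite-dimensional closed linear subspace of ℝ^ℕ (with the product topology) is linearly homeomorphic to ℝ^ℕ. -/
universe u

/-- Linearly independent functionals take arbitrary prescribed values on finitely many indices. -/
theorem exists_forall_mem_finset_dual_eq {K V ι : Type*} [Field K] [AddCommGroup V] [Module K V]
    {f : ι → Module.Dual K V} (hf : LinearIndependent K f) (s : Finset ι) (y : ι → K) :
    ∃ x : V, ∀ i ∈ s, f i x = y i := by
  classical
  let T : V →ₗ[K] (s → K) := LinearMap.pi fun i => f i
  have hT : LinearMap.range T = ⊤ := by
    by_contra h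
    obtain ⟨g, hg, hle⟩ := Submodule.exists_le_ker_of_lt_top _ (lt_top_iff_ne_top.2 h)
    have hs : LinearIndependent K fun i : s => f i := hf.comp _ Subtype.val_injective
    have key : ∀ i : s, g (Pi.single i 1) = 0 := by
      refine Fintype.linearIndependent_iff.1 hs (fun i => g (Pi.single i 1)) ?_
      ext x
      have hx : g (T x) = 0 := hle ⟨x, rfl⟩
      rw [pi_eq_sum_univ' (T x), map_sum] at hx
      simpa [T, mul_comm, -Finset.univ_eq_attach] using hx
    apply hg
    ext i
    simpa using key i
  obtain ⟨x, hx⟩ := LinearMap.range_eq_top.1 hT fun i => y i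
  exact ⟨x, fun i hi => congrFun hx ⟨i, hi⟩⟩

/-- A closed subspace of `ι → 𝕜` is linearly homeomorphic to `κ → 𝕜` by restriction to a
subfamily of coordinates indexed by an injection `κ → ι`. -/
theorem Submodule.exists_continuousLinearEquiv_pi_of_isClosed {𝕜 : Type*} {ι : Type u} [Field 𝕜]
    [TopologicalSpace 𝕜] [IsTopologicalRing 𝕜] (p : Submodule 𝕜 (ι → 𝕜))
    (hp : IsClosed (p : Set (ι → 𝕜))) :
    ∃ (κ : Type u) (a : κ → ι), Function.Injective a ∧ Nonempty (↥p ≃L[𝕜] (κ → 𝕜)) := by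
  let v : ι → Module.Dual 𝕜 p := fun n => LinearMap.proj n ∘ₗ p.subtype
  obtain ⟨κ, a, ha, hspan, hli⟩ := exists_linearIndependent' 𝕜 v
  have hc : ∀ n, ∃ c : κ →₀ 𝕜, (c.sum fun i r => r • v (a i)) = v n := fun n =>
    (Finsupp.mem_span_range_iff_exists_finsupp (v := v ∘ a)).1
      (hspan ▸ Submodule.subset_span ⟨n, rfl⟩)
  choose c hc using hc
  have hcoord : ∀ (x : p) (n : ι), ∑ i ∈ (c n).support, c n i * (x : ι → 𝕜) (a i) =
      (x : ι → 𝕜) n := by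
    intro x n
    simpa [Finsupp.sum, v] using congrArg (fun φ : Module.Dual 𝕜 p => φ x) (hc n)
  let S : (κ → 𝕜) →L[𝕜] (ι → 𝕜) := ContinuousLinearMap.pi fun n =>
    ∑ i ∈ (c n).support, c n i • ContinuousLinearMap.proj i
  have hS : ∀ y n, S y n = ∑ i ∈ (c n).support, c n i * y i := by
    intro y n
    simp [S]
  have hfin : ∀ (s : Finset κ) (y : κ → 𝕜), ∃ x : p, ∀ i ∈ s, (x : ι → 𝕜) (a i) = y i :=
    exists_forall_mem_finset_dual_eq hli
  have hSp : ∀ y, S y ∈ p := by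
    classical
    intro y
    rw [← SetLike.mem_coe, ← hp.closure_eq, _root_.mem_closure_iff]
    intro U hU hyU
    obtain ⟨I, u, hu, hIU⟩ := isOpen_pi_iff.1 hU _ hyU
    obtain ⟨x, hx⟩ := hfin (I.biUnion fun n => (c n).support) y
    refine ⟨x, hIU fun n hn => ?_, x.2⟩
    have : (x : ι → 𝕜) n = S y n := by
      rw [← hcoord x n, hS]
      exact Finset.sum_congr rfl fun i hi => by rw [hx i (Finset.mem_biUnion.2 ⟨n, hn, hi⟩)]
    rw [this]
    exact (hu n hn).2
  have hSa : ∀ y i, S y (a i) = y i := by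
    classical
    intro y i
    obtain ⟨x, hx⟩ := hfin (insert i (c (a i)).support) y
    rw [hS, ← hx i (Finset.mem_insert_self _ _), ← hcoord x (a i)]
    exact Finset.sum_congr rfl fun j hj => by rw [hx j (Finset.mem_insert_of_mem hj)]
  let R : p →L[𝕜] (κ → 𝕜) :=
    (ContinuousLinearMap.pi fun i => ContinuousLinearMap.proj (a i)) ∘L p.subtypeL
  refine ⟨κ, a, ha, ⟨ContinuousLinearEquiv.equivOfInverse R (S.codRestrict p hSp) ?_ ?_⟩⟩
  · intro x
    ext n
    exact (hS _ n).trans (hcoord x n)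
  · intro y
    ext i
    exact hSa y i

/-- Every infinite-dimensional closed linear subspace of `ℝ^ℕ` (with the product
topology) is linearly homeomorphic to `ℝ^ℕ`. -/
theorem closed_subspace_of_RN_iso_RN (p : Submodule ℝ (ℕ → ℝ))
    (hclosed : IsClosed (p : Set (ℕ → ℝ))) (hinf : ¬ FiniteDimensional ℝ ↥p) :
    Nonempty (↥p ≃L[ℝ] (ℕ → ℝ)) := by
  obtain ⟨κ, a, ha, ⟨e⟩⟩ := p.exists_continuousLinearEquiv_pi_of_isClosed hclosed
  have : Countable κ := ha.countable
  have : Infinite κ := by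
    by_contra h
    have : Finite κ := not_infinite_iff_finite.1 h
    exact hinf (Module.Finite.equiv e.symm.toLinearEquiv)
  obtain ⟨σ⟩ := nonempty_equiv_of_countable (α := κ) (β := ℕ)
  exact ⟨e.trans (ContinuousLinearEquiv.piCongrLeft ℝ (fun _ : ℕ => ℝ) σ)⟩
end

section
/- Let F ⊆ ℝ be a closed subset such that F \ [−n,n] is uncountable for every n ∈ ℕ. Then C(F), the space of continuous real-valued functions on F with the topology of uniform convergence on compact subsets of F, is linearly homeomorphic to C(ℝ), the space of continuous real-valued functions on ℝ with the topology of uniform convergence on compact subsets of ℝ. -/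
open Topology Filter

/-- Prepend a bit to a binary sequence. -/
def consBit (d : Bool) : C(ℕ → Bool, ℕ → Bool) where
  toFun ω n := Nat.casesOn n d ω
  continuous_toFun := by
    refine continuous_pi fun n => ?_
    cases n with
    | zero => exact continuous_const
    | succ n => exact continuous_apply n

@[simp] theorem consBit_zero (d : Bool) (ω : ℕ → Bool) : consBit d ω 0 = d := rfl

@[simp] theorem consBit_succ (d : Bool) (ω : ℕ → Bool) (n : ℕ) : consBit d ω (n + 1) = ω n := rfl

/-- Precomposition with a continuous map, as a continuous linear map. -/
def precompCLM {X Y : Type*} [TopologicalSpace X] [TopologicalSpace Y] (φ : C(X, Y)) :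
    C(Y, ℝ) →L[ℝ] C(X, ℝ) where
  toFun f := f.comp φ
  map_add' _ _ := rfl
  map_smul' _ _ := rfl
  cont := ContinuousMap.continuous_precomp φ

@[simp] theorem precompCLM_apply {X Y : Type*} [TopologicalSpace X] [TopologicalSpace Y]
    (φ : C(X, Y)) (f : C(Y, ℝ)) (x : X) : precompCLM φ f x = f (φ x) := rfl

section Markov

variable {S : Type*} [TopologicalSpace S] [CompactSpace S]

/-- `markovStep w T n g x` is the expected value of `g`, evaluated at the first `n` random bits
(followed by zeros), where from the state `x` the bit `d` is drawn with probability `w d x` and the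
state then moves to `T d x`. -/
noncomputable def markovStep (w : Bool → C(S, ℝ)) (T : Bool → C(S, S)) :
    ℕ → (C(ℕ → Bool, ℝ) →L[ℝ] C(S, ℝ))
  | 0 => precompCLM (ContinuousMap.const S fun _ => false)
  | n + 1 => ∑ d, ContinuousLinearMap.mul ℝ C(S, ℝ) (w d) ∘L precompCLM (T d) ∘L
      markovStep w T n ∘L precompCLM (consBit d)

variable {w : Bool → C(S, ℝ)} {T : Bool → C(S, S)}

theorem markovStep_zero_apply (g : C(ℕ → Bool, ℝ)) (x : S) :
    markovStep w T 0 g x = g fun _ => false := rfl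

theorem markovStep_succ_apply (n : ℕ) (g : C(ℕ → Bool, ℝ)) (x : S) :
    markovStep w T (n + 1) g x =
      w true x * markovStep w T n (g.comp (consBit true)) (T true x) +
        w false x * markovStep w T n (g.comp (consBit false)) (T false x) := by
  simp only [markovStep, Fintype.sum_bool]
  rfl

theorem abs_convexComb_sub_le {a b u v c ε : ℝ} (ha : 0 ≤ a) (hb : 0 ≤ b) (hab : a + b = 1)
    (hu : a ≠ 0 → |u - c| ≤ ε) (hv : b ≠ 0 → |v - c| ≤ ε) : |a * u + b * v - c| ≤ ε := by
  have h1 : a * |u - c| ≤ a * ε := by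
    rcases eq_or_ne a 0 with rfl | h
    · simp
    · exact mul_le_mul_of_nonneg_left (hu h) ha
  have h2 : b * |v - c| ≤ b * ε := by
    rcases eq_or_ne b 0 with rfl | h
    · simp
    · exact mul_le_mul_of_nonneg_left (hv h) hb
  calc |a * u + b * v - c| = |a * (u - c) + b * (v - c)| := by
        congr 1; linear_combination c * hab
    _ ≤ |a * (u - c)| + |b * (v - c)| := abs_add_le _ _
    _ = a * |u - c| + b * |v - c| := by rw [abs_mul, abs_mul, abs_of_nonneg ha, abs_of_nonneg hb]
    _ ≤ a * ε + b * ε := add_le_add h1 h2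
    _ = ε := by rw [← add_mul, hab, one_mul]

theorem abs_markovStep_sub_le (hw : ∀ d x, 0 ≤ w d x) (hw1 : ∀ x, w true x + w false x = 1)
    {A : ℕ → S → Set (ℕ → Bool)} (hA0 : ∀ x, (fun _ => false) ∈ A 0 x)
    (hA : ∀ n d x, w d x ≠ 0 → ∀ ω ∈ A n (T d x), consBit d ω ∈ A (n + 1) x)
    {c ε : ℝ} (n : ℕ) (g : C(ℕ → Bool, ℝ)) (x : S) (hg : ∀ ω ∈ A n x, |g ω - c| ≤ ε) :
    |markovStep w T n g x - c| ≤ ε := by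
  induction n generalizing g x with
  | zero => exact hg _ (hA0 x)
  | succ n ih =>
    rw [markovStep_succ_apply]
    exact abs_convexComb_sub_le (hw _ x) (hw _ x) (hw1 x)
      (fun h => ih _ _ fun ω hω => hg _ (hA n _ x h ω hω))
      (fun h => ih _ _ fun ω hω => hg _ (hA n _ x h ω hω))

theorem abs_markovStep_add_sub_le (hw : ∀ d x, 0 ≤ w d x) (hw1 : ∀ x, w true x + w false x = 1)
    {ε : ℝ} (n m : ℕ) (g : C(ℕ → Bool, ℝ)) (x : S)
    (hg : ∀ ω ω', (∀ i < n, ω i = ω' i) → |g ω - g ω'| ≤ ε) :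
    |markovStep w T (n + m) g x - markovStep w T n g x| ≤ ε := by
  induction n generalizing g x with
  | zero =>
    rw [Nat.zero_add, markovStep_zero_apply]
    exact abs_markovStep_sub_le hw hw1 (A := fun _ _ => Set.univ) (by simp) (by simp) _ _ _
      fun ω _ => hg _ _ (by simp)
  | succ n ih =>
    have key : ∀ d, |markovStep w T (n + m) (g.comp (consBit d)) (T d x) -
        markovStep w T n (g.comp (consBit d)) (T d x) - 0| ≤ ε := fun d => by
      rw [sub_zero]
      refine ih _ _ fun ω ω' h => hg _ _ fun i hi => ?_
      cases i with
      | zero => rfl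
      | succ i => exact h i (by omega)
    have := abs_convexComb_sub_le (hw _ x) (hw _ x) (hw1 x) (fun _ => key true) fun _ => key false
    rw [Nat.add_right_comm, markovStep_succ_apply, markovStep_succ_apply]
    convert this using 2
    ring

theorem exists_forall_agree_abs_sub_lt (g : C(ℕ → Bool, ℝ)) {ε : ℝ} (hε : 0 < ε) :
    ∃ n : ℕ, ∀ ω ω', (∀ i < n, ω i = ω' i) → |g ω - g ω'| < ε := by
  let V : ℕ → Set ((ℕ → Bool) × (ℕ → Bool)) := fun n => {p | ∀ i < n, p.1 i = p.2 i}
  have hV : ∀ n, IsClosed (V n) := fun n => by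
    simp only [V, Set.ofPred_forall]
    exact isClosed_iInter fun i => isClosed_iInter fun _ =>
      isClosed_eq (by fun_prop) (by fun_prop)
  have hanti : Antitone V := fun m n hmn p hp i hi => hp i (hi.trans_le hmn)
  obtain ⟨n, hn⟩ := exists_subset_nhds_of_compactSpace (V := V) hanti.directed_ge hV
    (U := {p | |g p.1 - g p.2| < ε}) (fun p hp => by
      refine (isOpen_lt (by fun_prop) continuous_const).mem_nhds ?_
      have : p.1 = p.2 := funext fun i => Set.mem_iInter.1 hp (i + 1) i (Nat.lt_succ_self i)
      simpa [this] using hε)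
  exact ⟨n, fun ω ω' h => hn (a := (ω, ω')) h⟩

/-- Limit of the Markov averaging operators. Its value at `x` only depends on the restriction to
any closed set that supports the random sequence started at `x`. -/
theorem exists_averaging_operator (hw : ∀ d x, 0 ≤ w d x)
    (hw1 : ∀ x, w true x + w false x = 1) :
    ∃ V : C(ℕ → Bool, ℝ) →L[ℝ] C(S, ℝ), ∀ A : ℕ → S → Set (ℕ → Bool),
      (∀ n x, IsClosed (A n x)) → (∀ x, Antitone fun n => A n x) →
      (∀ x, (fun _ => false) ∈ A 0 x) →
      (∀ n d x, w d x ≠ 0 → ∀ ω ∈ A n (T d x), consBit d ω ∈ A (n + 1) x) →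
      ∀ x (g : C(ℕ → Bool, ℝ)) (c : ℝ), (∀ ω, (∀ n, ω ∈ A n x) → g ω = c) → V g x = c := by
  have hlim : ∀ g : C(ℕ → Bool, ℝ), ∃ f, Tendsto (fun n => markovStep w T n g) atTop (𝓝 f) := by
    refine fun g => cauchySeq_tendsto_of_complete (Metric.cauchySeq_iff'.2 fun ε hε => ?_)
    obtain ⟨N, hN⟩ := exists_forall_agree_abs_sub_lt g (half_pos hε)
    refine ⟨N, fun n hn => lt_of_le_of_lt ?_ (half_lt_self hε)⟩
    obtain ⟨m, rfl⟩ := Nat.exists_eq_add_of_le hn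
    exact (ContinuousMap.dist_le (half_pos hε).le).2 fun x =>
      abs_markovStep_add_sub_le hw hw1 N m g x fun ω ω' h => (hN ω ω' h).le
  choose V hV using hlim
  refine ⟨continuousLinearMapOfTendsto (markovStep w T) (f := V) (tendsto_pi_nhds.2 hV), ?_⟩
  intro A hcl hanti hA0 hA x g c hc
  change V g x = c
  have hx : Tendsto (fun n => markovStep w T n g x) atTop (𝓝 (V g x)) :=
    ((continuous_eval_const (F := C(S, ℝ)) x).tendsto _).comp (hV g)
  refine tendsto_nhds_unique hx (Metric.tendsto_atTop.2 fun ε hε => ?_)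
  obtain ⟨N, hN⟩ := exists_subset_nhds_of_compactSpace (V := fun n => A n x)
    (hanti x).directed_ge (fun n => hcl n x) (U := {ω | |g ω - c| < ε / 2}) (fun ω hω => by
      refine (isOpen_lt (by fun_prop) continuous_const).mem_nhds ?_
      simpa [hc ω (Set.mem_iInter.1 hω)] using hε)
  exact ⟨N, fun n hn => (abs_markovStep_sub_le hw hw1 hA0 hA n g x fun ω hω =>
    (hN (hanti x hn hω)).le).trans_lt (half_lt_self hε)⟩

end Markov

/-- **Milutin's lemma**: the interval is the image of Cantor space under a map admitting a
continuous linear averaging operator. -/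
theorem exists_milutin_map : ∃ (φ : C(ℕ → Bool, unitInterval))
    (V : C(ℕ → Bool, ℝ) →L[ℝ] C(unitInterval, ℝ)), ∀ x (g : C(ℕ → Bool, ℝ)) (c : ℝ),
      (∀ ω, φ ω = x → g ω = c) → V g x = c := by
  have h0 : (0 : ℝ) ≤ 2 / 3 := by norm_num
  have h1 : (2 / 3 : ℝ) < 1 := by norm_num
  set ψ : (ℕ → Bool) → ℝ := fun ω => 1 / 3 * Cardinal.cantorFunction (2 / 3) ω with hψ
  have hψsucc : ∀ d ω, ψ (consBit d ω) = cond d (1 / 3) 0 + 2 / 3 * ψ ω := fun d ω => by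
    simp only [hψ]
    rw [Cardinal.cantorFunction_succ _ h0 h1]
    cases d <;> simp <;> ring
  have hψcont : Continuous ψ := by
    refine continuous_const.mul (continuous_tsum (u := fun n => (2 / 3 : ℝ) ^ n) (fun n => ?_)
      (summable_geometric_of_lt_one h0 h1) fun n ω => ?_)
    · exact (continuous_of_discreteTopology (f := fun b : Bool => cond b ((2 / 3 : ℝ) ^ n) 0)).comp
        (continuous_apply n)
    · cases h : ω n <;> simp [Cardinal.cantorFunctionAux, h, pow_nonneg h0]
  have hψmem : ∀ ω, ψ ω ∈ Set.Icc (0 : ℝ) 1 := fun ω => by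
    refine ⟨mul_nonneg (by norm_num) (tsum_nonneg fun n => Cardinal.cantorFunctionAux_nonneg h0),
      ?_⟩
    have := Cardinal.cantorFunction_le (f := ω) (g := fun _ => true) h0 h1 (by simp)
    have htrue : Cardinal.cantorFunction (2 / 3) (fun _ => true) = 3 := by
      have := Cardinal.cantorFunction_succ (fun _ => true) h0 h1
      simp only [cond_true] at this
      linarith
    simp only [hψ]
    linarith
  let p : C(unitInterval, ℝ) := ⟨fun x => max 0 (min 1 (3 * x - 1)), by fun_prop⟩
  let w : Bool → C(unitInterval, ℝ) := fun d => cond d p (1 - p)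
  let T : Bool → C(unitInterval, unitInterval) := fun d =>
    ⟨fun x => Set.projIcc 0 1 zero_le_one (3 / 2 * (x - cond d (1 / 3) 0)),
      continuous_projIcc.comp (by fun_prop)⟩
  have hp0 : ∀ x, 0 ≤ p x := fun x => le_max_left _ _
  have hp1 : ∀ x, p x ≤ 1 := fun x => max_le zero_le_one (min_le_left _ _)
  have hT : ∀ d x, w d x ≠ 0 → (T d x : ℝ) = 3 / 2 * (x - cond d (1 / 3) 0) := fun d x hx => by
    have hmem : 3 / 2 * ((x : ℝ) - cond d (1 / 3) 0) ∈ Set.Icc (0 : ℝ) 1 := by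
      have := x.2.1
      have := x.2.2
      cases d with
      | true =>
        have : 1 < 3 * (x : ℝ) := by
          by_contra! h
          exact hx (max_eq_left ((min_le_right _ _).trans (by linarith)))
        constructor <;> simp only [cond_true] <;> linarith
      | false =>
        have : 3 * (x : ℝ) < 2 := by
          by_contra! h
          refine hx ?_
          have : min 1 (3 * (x : ℝ) - 1) = 1 := min_eq_left (by linarith)
          simp [w, p, this]
        constructor <;> simp only [cond_false] <;> linarith
    exact congrArg Subtype.val (Set.projIcc_of_mem zero_le_one hmem)
  obtain ⟨V, hV⟩ := exists_averaging_operator (w := w) (T := T)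
    (fun d x => by cases d <;> simp [w, hp0, hp1]) (fun x => by simp [w])
  refine ⟨⟨fun ω => ⟨ψ ω, hψmem ω⟩, by fun_prop⟩, V, fun x g c hg => ?_⟩
  refine hV (fun n x => {ω | |ψ ω - x| ≤ (2 / 3) ^ n}) (fun n x => ?_) (fun x m n hmn ω hω => ?_)
    (fun x => ?_) (fun n d x hx ω hω => ?_) x g c fun ω hω => hg ω (Subtype.ext ?_)
  · exact isClosed_le (by fun_prop) continuous_const
  · exact le_trans hω (pow_le_pow_of_le_one h0 h1.le hmn)
  · have h2 := hψmem fun _ => false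
    have h3 := x.2
    simp only [Set.mem_ofPred_eq, pow_zero, abs_le]
    constructor <;> linarith [h2.1, h2.2, h3.1, h3.2]
  · simp only [Set.mem_ofPred_eq, hT d x hx] at hω ⊢
    rw [hψsucc, pow_succ']
    refine le_trans (le_of_eq ?_) (mul_le_mul_of_nonneg_left hω h0)
    rw [← abs_of_nonneg h0, ← abs_mul, abs_of_nonneg h0]
    congr 1
    ring
  · have : |ψ ω - x| ≤ 0 :=
      ge_of_tendsto' (tendsto_pow_atTop_nhds_zero_of_lt_one h0 h1) hω
    exact sub_eq_zero.1 (abs_nonpos_iff.1 this)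

/-- Cantor space as the set of vertices of the Hilbert cube. -/
def cubeVertex : C(ℕ → Bool, ℕ → unitInterval) where
  toFun ω i := cond (ω i) 1 0
  continuous_toFun := continuous_pi fun i =>
    (continuous_of_discreteTopology (f := fun b : Bool => cond b (1 : unitInterval) 0)).comp
      (continuous_apply i)

/-- Functions on the vertices of the Hilbert cube extend linearly to the cube. -/
theorem exists_cube_extension : ∃ U : C(ℕ → Bool, ℝ) →L[ℝ] C(ℕ → unitInterval, ℝ),
    ∀ g ω, U g (cubeVertex ω) = g ω := by
  let p : C(ℕ → unitInterval, ℝ) := ⟨fun y => y 0, by fun_prop⟩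
  let w : Bool → C(ℕ → unitInterval, ℝ) := fun d => cond d p (1 - p)
  let T : Bool → C(ℕ → unitInterval, ℕ → unitInterval) := fun _ =>
    ⟨fun y i => y (i + 1), by fun_prop⟩
  obtain ⟨U, hU⟩ := exists_averaging_operator (w := w) (T := T)
    (fun d y => by cases d <;> simp [w, p, (y 0).2.1, (y 0).2.2]) (fun y => by simp [w])
  refine ⟨U, fun g ω => ?_⟩
  refine hU (fun n y => {ω | ∀ i < n, y i ≠ cond (ω i) 0 1}) (fun n y => ?_)
    (fun y m n hmn ω hω i hi => hω i (hi.trans_le hmn)) (by simp) (fun n d y hy ω hω i hi => ?_)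
    _ g _ fun ω' hω' => congrArg g (funext fun i => ?_)
  · simp only [Set.ofPred_forall]
    exact isClosed_iInter fun i => isClosed_iInter fun _ =>
      (isClosed_discrete {b : Bool | y i ≠ cond b 0 1}).preimage
        (continuous_apply (A := fun _ : ℕ => Bool) i)
  · cases i with
    | zero =>
      intro h
      cases d <;> simp_all [w, p]
    | succ i => exact hω i (by omega)
  · have := hω' (i + 1) i (Nat.lt_succ_self i)
    change cond (ω i) 1 0 ≠ cond (ω' i) (0 : unitInterval) 1 at this
    revert this
    cases ω i <;> cases ω' i <;> simp

/-- Locally finite sums of continuous linear operators into a space `C(X, ℝ)`. -/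
theorem exists_locallyFinite_sum {ι X E : Type*} [TopologicalSpace X] [LocallyCompactSpace X]
    [AddCommGroup E] [Module ℝ E] [TopologicalSpace E] (χ : ι → C(X, ℝ))
    (hχ : LocallyFinite fun i => Function.support (χ i)) (L : ι → E →L[ℝ] C(X, ℝ)) :
    ∃ W : (ι → E) →L[ℝ] C(X, ℝ), ∀ g x, W g x = ∑ᶠ i, χ i x * L i (g i) x := by
  have hcont : Continuous fun q : (ι → E) × X => ∑ᶠ i, χ i q.2 * L i (q.1 i) q.2 := by
    refine continuous_finsum (fun i => ?_)
      ((hχ.preimage_continuous continuous_snd).subset fun i q hq => ?_)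
    · exact ((χ i).continuous.comp continuous_snd).mul (continuous_eval.comp
        (((L i).continuous.comp ((continuous_apply i).comp continuous_fst)).prodMk continuous_snd))
    · exact left_ne_zero_of_mul hq
  have hfin : ∀ x (g : ι → E), (Function.support fun i => χ i x * L i (g i) x).Finite :=
    fun x g => (hχ.point_finite x).subset fun i hi => left_ne_zero_of_mul hi
  refine ⟨⟨⟨⟨fun g => ⟨fun x => ∑ᶠ i, χ i x * L i (g i) x,
    hcont.comp (continuous_const.prodMk continuous_id)⟩, fun g h => ?_⟩, fun a g => ?_⟩,
    ContinuousMap.continuous_of_continuous_uncurry _ hcont⟩, fun g x => rfl⟩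
  · ext x
    simp only [Pi.add_apply, map_add, ContinuousMap.add_apply, ContinuousMap.coe_mk, mul_add]
    exact finsum_add_distrib (hfin x g) (hfin x h)
  · ext x
    simp only [Pi.smul_apply, map_smul, ContinuousMap.smul_apply, ContinuousMap.coe_mk,
      RingHom.id_apply, mul_smul_comm]
    exact (smul_finsum a _).symm

/-- Pełczyński decomposition: a space which is complemented in a countable power `ι → E`, and in
which that power is complemented, is isomorphic to it. -/
theorem nonempty_equiv_of_complemented.{u} {X E : Type u} [AddCommGroup X] [Module ℝ X]
    [TopologicalSpace X] [IsTopologicalAddGroup X] [AddCommGroup E] [Module ℝ E]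
    [TopologicalSpace E] [IsTopologicalAddGroup E]
    (u : X →L[ℝ] (ℕ → E)) (v : (ℕ → E) →L[ℝ] X) (hvu : Function.LeftInverse v u)
    (s : (ℕ → E) →L[ℝ] X) (r : X →L[ℝ] (ℕ → E)) (hrs : Function.LeftInverse r s) :
    Nonempty (X ≃L[ℝ] (ℕ → E)) := by
  have cons (Y : Type u) [AddCommGroup Y] [Module ℝ Y] [TopologicalSpace Y] :
      Nonempty ((Y × (ℕ → Y)) ≃L[ℝ] (ℕ → Y)) := ⟨
    { toFun := fun q n => Nat.casesOn n q.1 q.2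
      invFun := fun f => (f 0, fun n => f (n + 1))
      map_add' := fun _ _ => by ext n; cases n <;> rfl
      map_smul' := fun _ _ => by ext n; cases n <;> rfl
      left_inv := fun _ => rfl
      right_inv := fun _ => by ext n; cases n <;> rfl
      continuous_toFun := continuous_pi fun n => by
        cases n with
        | zero => exact continuous_fst
        | succ n => exact (continuous_apply n).comp continuous_snd
      continuous_invFun := by fun_prop }⟩
  let curry : (ℕ → E) ≃L[ℝ] (ℕ → ℕ → E) :=
    { toFun := fun f m n => f (Nat.pair m n)
      invFun := fun f k => f k.unpair.1 k.unpair.2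
      map_add' := fun _ _ => rfl
      map_smul' := fun _ _ => rfl
      left_inv := fun _ => by simp
      right_inv := fun _ => by simp
      continuous_toFun := by fun_prop
      continuous_invFun := by fun_prop }
  let zX := ContinuousLinearEquiv.equivOfRightInverse v u hvu
  let xZ := ContinuousLinearEquiv.equivOfRightInverse r s hrs
  let split : ((ℕ → X) × (ℕ → v.ker)) ≃L[ℝ] (ℕ → X × v.ker) :=
    { toFun := fun q n => (q.1 n, q.2 n)
      invFun := fun f => (fun n => (f n).1, fun n => (f n).2)
      map_add' := fun _ _ => rfl
      map_smul' := fun _ _ => rfl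
      left_inv := fun _ => rfl
      right_inv := fun _ => rfl
      continuous_toFun := by fun_prop
      continuous_invFun := by fun_prop }
  obtain ⟨consX⟩ := cons X
  obtain ⟨consZ⟩ := cons (ℕ → E)
  let pow : (ℕ → E) ≃L[ℝ] ((ℕ → X) × (ℕ → v.ker)) :=
    (curry.trans (ContinuousLinearEquiv.piCongrRight fun _ => zX)).trans split.symm
  let absorbX : (X × (ℕ → E)) ≃L[ℝ] (ℕ → E) :=
    ((((ContinuousLinearEquiv.refl ℝ X).prodCongr pow).trans
      (ContinuousLinearEquiv.prodAssoc ℝ X (ℕ → X) (ℕ → v.ker)).symm).trans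
        (consX.prodCongr (ContinuousLinearEquiv.refl ℝ _))).trans pow.symm
  let double : ((ℕ → E) × (ℕ → E)) ≃L[ℝ] (ℕ → E) :=
    (((ContinuousLinearEquiv.refl ℝ _).prodCongr curry).trans consZ).trans curry.symm
  let absorbZ : X ≃L[ℝ] ((ℕ → E) × X) :=
    ((xZ.trans (double.symm.prodCongr (ContinuousLinearEquiv.refl ℝ _))).trans
      (ContinuousLinearEquiv.prodAssoc ℝ (ℕ → E) (ℕ → E) r.ker)).trans
        ((ContinuousLinearEquiv.refl ℝ _).prodCongr xZ.symm)
  exact ⟨absorbZ.trans ((ContinuousLinearEquiv.prodComm ℝ (ℕ → E) X).trans absorbX)⟩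

/-- A map from Cantor space can be modified off the preimage of a nonempty closed set so as to take
values in that set. -/
theorem exists_map_into_closed {X : Type*} [TopologicalSpace X] {F : Set X} (hF : IsClosed F)
    (hne : F.Nonempty) (φ : C(ℕ → Bool, X)) :
    ∃ ρ : C(ℕ → Bool, F), ∀ ω, φ ω ∈ F → (ρ ω : X) = φ ω := by
  rcases (φ ⁻¹' F).eq_empty_or_nonempty with h | h
  · obtain ⟨a, ha⟩ := hne
    exact ⟨ContinuousMap.const _ ⟨a, ha⟩,
      fun ω hω => absurd hω (Set.eq_empty_iff_forall_notMem.1 h ω)⟩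
  · obtain ⟨f, hf, -, hfc⟩ :=
      PiNat.exists_retraction_subtype_of_isClosed (hF.preimage φ.continuous) h
    refine ⟨⟨fun ω => ⟨φ (f ω), (f ω).2⟩, by fun_prop⟩, fun ω hω => ?_⟩
    exact congrArg (fun y : φ ⁻¹' F => φ y) (hf ⟨ω, hω⟩)

/-- `C(F, ℝ)` is complemented in a countable power of the functions on Cantor space. -/
theorem exists_complement_in_cantor_power {F : Set ℝ} (hF : IsClosed F) (hne : F.Nonempty) :
    ∃ (u : C(F, ℝ) →L[ℝ] (ℕ → C(ℕ → Bool, ℝ))) (v : (ℕ → C(ℕ → Bool, ℝ)) →L[ℝ] C(F, ℝ)),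
      Function.LeftInverse v u := by
  have := hF.locallyCompactSpace
  obtain ⟨φ, V, hV⟩ := exists_milutin_map
  choose ρ hρ using fun n : ℕ => exists_map_into_closed hF hne
    ⟨fun ω => ((n : ℝ) + 1) * (2 * φ ω - 1), by fun_prop⟩
  obtain ⟨χ, hχ⟩ := PartitionOfUnity.exists_isSubordinate (X := F) isClosed_univ
    (fun n : ℕ => {x : F | |(x : ℝ)| < n + 1}) (fun n => isOpen_lt (by fun_prop) continuous_const)
    fun x _ => Set.mem_iUnion.2 ((exists_nat_gt |(x : ℝ)|).imp fun n hn =>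
      hn.trans (lt_add_one _))
  let P : ℕ → C(F, unitInterval) := fun n =>
    ⟨fun x => Set.projIcc 0 1 zero_le_one (((x : ℝ) / (n + 1) + 1) / 2),
      continuous_projIcc.comp (by fun_prop)⟩
  obtain ⟨W, hW⟩ := exists_locallyFinite_sum (fun n => χ n) χ.locallyFinite
    fun n => precompCLM (P n) ∘L V
  refine ⟨ContinuousLinearMap.pi fun n => precompCLM (ρ n), W, fun f => ?_⟩
  ext x
  rw [hW]
  calc _ = ∑ᶠ n, χ n x * f x := finsum_congr fun n => ?_
    _ = f x := by rw [← finsum_mul' _ _ (χ.locallyFinite.point_finite x),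
      χ.sum_eq_one (Set.mem_univ x), one_mul]
  rcases eq_or_ne (χ n x) 0 with h | h
  · rw [h, zero_mul, zero_mul]
  congr 1
  have hx : |(x : ℝ)| < n + 1 := hχ n (subset_tsupport _ h)
  have hn : (0 : ℝ) < n + 1 := by positivity
  have hP : (P n x : ℝ) = ((x : ℝ) / (n + 1) + 1) / 2 := by
    refine congrArg Subtype.val (Set.projIcc_of_mem zero_le_one ?_)
    rw [abs_lt] at hx
    have h1 : -1 ≤ (x : ℝ) / (n + 1) := by rw [le_div_iff₀ hn]; linarith
    have h2 : (x : ℝ) / (n + 1) ≤ 1 := by rw [div_le_iff₀ hn]; linarith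
    constructor <;> linarith
  refine hV (P n x) _ _ fun ω hω => congrArg f (Subtype.ext ?_)
  have hφ : ((n : ℝ) + 1) * (2 * φ ω - 1) = x := by
    rw [hω, hP]
    field_simp
    ring
  exact (hρ n ω (by simp [hφ])).trans hφ

/-- A closed set which is uncountable near infinity contains Cantor sets in a sequence of annuli
that are at distance at least one from each other. -/
theorem exists_cantor_sets {F : Set ℝ} (hF : IsClosed F)
    (huncount : ∀ n : ℕ, ¬ (F \ Set.Icc (-(n : ℝ)) (n : ℝ)).Countable) :
    ∃ (j : ℕ → ℕ) (e : ℕ → (ℕ → Bool) → F), (∀ m n, m < n → j m + 2 ≤ j n) ∧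
      (∀ n, Continuous (e n)) ∧ (∀ n, Function.Injective (e n)) ∧
      ∀ n ω, (j n : ℝ) ≤ |(e n ω : ℝ)| ∧ |(e n ω : ℝ)| ≤ j n + 1 := by
  let A : ℕ → Set ℝ := fun k => F ∩ {x | (k : ℝ) ≤ |x| ∧ |x| ≤ k + 1}
  have hfreq : ∃ᶠ k in atTop, ¬ (A k).Countable := by
    rw [frequently_atTop]
    intro n
    by_contra! h
    refine huncount n (Set.Countable.mono (fun x hx => ?_)
      (Set.countable_iUnion fun k => Set.countable_iUnion fun hk : n ≤ k => h k hk))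
    have hnx : (n : ℝ) ≤ |x| := by
      by_contra! hlt
      exact hx.2 (abs_le.1 hlt.le)
    exact Set.mem_iUnion₂.2 ⟨⌊|x|⌋₊, Nat.le_floor hnx, hx.1, Nat.floor_le (abs_nonneg x),
      (Nat.lt_floor_add_one _).le⟩
  obtain ⟨φ, hφ, hφA⟩ := extraction_of_frequently_atTop hfreq
  have hA : ∀ k, IsClosed (A k) := fun k => hF.inter
    ((isClosed_le continuous_const continuous_abs).inter
      (isClosed_le continuous_abs continuous_const))
  choose e he hec hei using fun n =>
    (hA (φ (2 * n))).exists_nat_bool_injection_of_not_countable (hφA (2 * n))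
  have hmem : ∀ n ω, e n ω ∈ A (φ (2 * n)) := fun n ω => he n ⟨ω, rfl⟩
  refine ⟨fun n => φ (2 * n), fun n ω => ⟨e n ω, (hmem n ω).1⟩, fun m n hmn => ?_,
    fun n => (hec n).subtype_mk _, fun n ω ω' h => hei n (congrArg Subtype.val h),
    fun n ω => (hmem n ω).2⟩
  have h1 := hφ (show 2 * m < 2 * m + 1 by omega)
  have h2 := hφ (show 2 * m + 1 < 2 * n by omega)
  simp only
  omega

/-- A countable power of the functions on Cantor space is complemented in `C(F, ℝ)`. -/
theorem exists_cantor_power_complement {F : Set ℝ} (hF : IsClosed F)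
    (huncount : ∀ n : ℕ, ¬ (F \ Set.Icc (-(n : ℝ)) (n : ℝ)).Countable) :
    ∃ (s : (ℕ → C(ℕ → Bool, ℝ)) →L[ℝ] C(F, ℝ)) (r : C(F, ℝ) →L[ℝ] (ℕ → C(ℕ → Bool, ℝ))),
      Function.LeftInverse r s := by
  have := hF.locallyCompactSpace
  obtain ⟨j, e, hj, hec, hei, he⟩ := exists_cantor_sets hF huncount
  obtain ⟨U, hU⟩ := exists_cube_extension
  choose P hP using fun n =>
    ContinuousMap.exists_extension ((hec n).isClosedEmbedding (hei n)) cubeVertex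
  have hPe : ∀ n ω, P n (e n ω) = cubeVertex ω := fun n ω => DFunLike.congr_fun (hP n) ω
  let χ : ℕ → C(F, ℝ) := fun n =>
    ⟨fun x => max 0 (min 1 (min (|(x : ℝ)| - j n + 1) (j n + 2 - |(x : ℝ)|))), by fun_prop⟩
  have hχ1 : ∀ n ω, χ n (e n ω) = 1 := fun n ω => by
    have := he n ω
    have h1 : 1 ≤ min (|(e n ω : ℝ)| - j n + 1) (j n + 2 - |(e n ω : ℝ)|) :=
      le_min (by linarith) (by linarith)
    simp [χ, min_eq_left h1]
  have hχlow : ∀ n (x : F), |(x : ℝ)| ≤ j n - 1 → χ n x = 0 := fun n x hx =>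
    max_eq_left ((min_le_right _ _).trans ((min_le_left _ _).trans (by linarith)))
  have hχhigh : ∀ n (x : F), j n + 2 ≤ |(x : ℝ)| → χ n x = 0 := fun n x hx =>
    max_eq_left ((min_le_right _ _).trans ((min_le_right _ _).trans (by linarith)))
  have hjcast : ∀ m n, m < n → (j m : ℝ) + 2 ≤ j n := fun m n h => by exact_mod_cast hj m n h
  have hχ0 : ∀ m n ω, m ≠ n → χ m (e n ω) = 0 := fun m n ω hmn => by
    have := he n ω
    rcases hmn.lt_or_gt with h | h
    · exact hχhigh _ _ (by linarith [hjcast m n h])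
    · exact hχlow _ _ (by linarith [hjcast n m h])
  have hjn : ∀ n, n ≤ j n := fun _ => (strictMono_nat_of_lt_succ fun n => by
    have := hj n (n + 1) (Nat.lt_succ_self n); omega : StrictMono j).le_apply
  have hloc : LocallyFinite fun n => Function.support (χ n) := fun x => by
    refine ⟨{y : F | |(y : ℝ)| < |(x : ℝ)| + 1},
      (isOpen_lt (by fun_prop) continuous_const).mem_nhds (by simp),
      (Set.finite_Iio (⌈|(x : ℝ)|⌉₊ + 2)).subset ?_⟩
    rintro n ⟨y, hy, hyx⟩
    by_contra! hn
    refine hy (hχlow n y ?_)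
    have h1 : |(y : ℝ)| < |(x : ℝ)| + 1 := hyx
    have h2 := Nat.le_ceil |(x : ℝ)|
    have h3 : ((⌈|(x : ℝ)|⌉₊ + 2 : ℕ) : ℝ) ≤ j n := by
      exact_mod_cast (not_lt.1 hn).trans (hjn n)
    push_cast at h3
    linarith
  obtain ⟨W, hW⟩ := exists_locallyFinite_sum χ hloc fun n => precompCLM (P n) ∘L U
  refine ⟨W, ContinuousLinearMap.pi fun n => precompCLM ⟨e n, hec n⟩, fun g => ?_⟩
  ext n ω
  change W g (e n ω) = g n ω
  rw [hW, finsum_eq_single _ n fun m hm => by rw [hχ0 m n ω hm, zero_mul], hχ1, one_mul]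
  change U (g n) (P n (e n ω)) = g n ω
  rw [hPe, hU]

/-- For a closed set `F ⊆ ℝ` which is uncountable near infinity, `C(F, ℝ)` is isomorphic to a
countable power of the space of continuous functions on Cantor space. -/
theorem nonempty_equiv_cantor_power {F : Set ℝ} (hF : IsClosed F)
    (huncount : ∀ n : ℕ, ¬ (F \ Set.Icc (-(n : ℝ)) (n : ℝ)).Countable) :
    Nonempty (C(F, ℝ) ≃L[ℝ] (ℕ → C(ℕ → Bool, ℝ))) := by
  have hne : F.Nonempty := by
    by_contra! h
    exact huncount 0 (by simp [h])
  obtain ⟨u, v, hvu⟩ := exists_complement_in_cantor_power hF hne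
  obtain ⟨s, r, hrs⟩ := exists_cantor_power_complement hF huncount
  exact nonempty_equiv_of_complemented u v hvu s r hrs

/-- Let `F ⊆ ℝ` be closed with `F \\ [-n, n]` uncountable for every `n`.  Then `C(F)`
(continuous real functions on `F` with the compact-open topology, i.e. the topology of
uniform convergence on compact subsets of `F`) is linearly homeomorphic to `C(ℝ)`. -/
theorem CF_iso_CR (F : Set ℝ) (hF : IsClosed F)
    (huncount : ∀ n : ℕ, ¬ (F \ Set.Icc (-(n : ℝ)) (n : ℝ)).Countable) :
    Nonempty (C(F, ℝ) ≃L[ℝ] C(ℝ, ℝ)) := by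
  obtain ⟨a⟩ := nonempty_equiv_cantor_power hF huncount
  obtain ⟨b⟩ := nonempty_equiv_cantor_power (F := Set.univ) isClosed_univ fun n h => by
    have hIoo : (Set.Ioo (n : ℝ) (n + 1)).Countable :=
      h.mono fun x (hx : x ∈ Set.Ioo (n : ℝ) (n + 1)) =>
        Set.mem_sdiff_of_mem (Set.mem_univ x) fun hx' => hx.1.not_ge hx'.2
    rw [Cardinal.Real.Ioo_countable_iff] at hIoo
    linarith
  let toReal : C((Set.univ : Set ℝ), ℝ) ≃L[ℝ] C(ℝ, ℝ) :=
    ContinuousLinearEquiv.equivOfInverse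
      (precompCLM ⟨fun x : ℝ => (⟨x, trivial⟩ : (Set.univ : Set ℝ)), by fun_prop⟩)
      (precompCLM ⟨fun x : (Set.univ : Set ℝ) => (x : ℝ), by fun_prop⟩)
      (fun _ => rfl) fun _ => rfl
  exact ⟨(a.trans b.symm).trans toReal⟩
end
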